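/- arXiv:1601.02177 — 4 statements merged into one kernel-verified Lean document; each statement's English description precedes it below -/
import Mathlib

section
/- Let p : ℝ → [0, ∞) be a probability density with respect to Lebesgue measure and suppose there are K < ∞ and a real α > 1 such that p(u) ≤ K (1+|u|)^{−α} for all u ∈ ℝ. Then for every γ ∈ (0, min(α/2, α−1)) there exists a finite constant C such that for all θ, θ0 ∈ ℝ with |θ − θ0| ≥ 1: ∫_ℝ √( p(x−θ) p(x−θ0) ) dx ≤ C |θ − θ0|^{−γ}. In particular, the location family p_θ(x) := p(x−θ) satisfies condition (D1). -/
open MeasureTheory Real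

/-- If `m ≤ M` are positive and `Δ ≤ m + M`, a power of `M` can be traded for a power of `Δ`. -/
theorem rpow_mul_rpow_le_of_le_add {m M Δ α γ : ℝ} (hm : 0 < m) (hmM : m ≤ M)
    (hΔ : 0 < Δ) (hΔle : Δ ≤ m + M) (hγ : 0 ≤ γ) (hγα : γ ≤ α / 2) :
    m ^ (-(α / 2)) * M ^ (-(α / 2)) ≤ (Δ / 2) ^ (-γ) * m ^ (-(α - γ)) := by
  have hM : 0 < M := hm.trans_le hmM
  have hsplit : M ^ (-(α / 2)) = M ^ (-γ) * M ^ (-(α / 2 - γ)) := by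
    rw [← rpow_add hM]; ring_nf
  have hjoin : m ^ (-(α - γ)) = m ^ (-(α / 2)) * m ^ (-(α / 2 - γ)) := by
    rw [← rpow_add hm]; ring_nf
  have hΔM : M ^ (-γ) ≤ (Δ / 2) ^ (-γ) :=
    rpow_le_rpow_of_nonpos (by positivity) (by linarith) (by linarith)
  have hmM' : M ^ (-(α / 2 - γ)) ≤ m ^ (-(α / 2 - γ)) :=
    rpow_le_rpow_of_nonpos hm hmM (by linarith)
  calc m ^ (-(α / 2)) * M ^ (-(α / 2))
      = m ^ (-(α / 2)) * (M ^ (-γ) * M ^ (-(α / 2 - γ))) := by rw [hsplit]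
    _ ≤ m ^ (-(α / 2)) * ((Δ / 2) ^ (-γ) * m ^ (-(α / 2 - γ))) := by gcongr
    _ = (Δ / 2) ^ (-γ) * m ^ (-(α - γ)) := by rw [hjoin]; ring

theorem rpow_mul_rpow_le_add {a b Δ α γ : ℝ} (ha : 0 < a) (hb : 0 < b)
    (hΔ : 0 < Δ) (hΔle : Δ ≤ a + b) (hγ : 0 ≤ γ) (hγα : γ ≤ α / 2) :
    a ^ (-(α / 2)) * b ^ (-(α / 2)) ≤
      (Δ / 2) ^ (-γ) * (a ^ (-(α - γ)) + b ^ (-(α - γ))) := by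
  have hA : 0 ≤ (Δ / 2) ^ (-γ) * a ^ (-(α - γ)) := by positivity
  have hB : 0 ≤ (Δ / 2) ^ (-γ) * b ^ (-(α - γ)) := by positivity
  rw [mul_add]
  rcases le_total a b with h | h
  · linarith [rpow_mul_rpow_le_of_le_add ha h hΔ hΔle hγ hγα]
  · rw [mul_comm (a ^ _)]
    linarith [rpow_mul_rpow_le_of_le_add hb h hΔ (by linarith) hγ hγα]

theorem sqrt_mul_le_of_le_mul_rpow {s t K a b α : ℝ} (ht : 0 ≤ t) (hK : 0 ≤ K)
    (ha : 0 < a) (hb : 0 < b) (hsa : s ≤ K * a ^ (-α)) (htb : t ≤ K * b ^ (-α)) :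
    √(s * t) ≤ K * (a ^ (-(α / 2)) * b ^ (-(α / 2))) := by
  have hsq : ∀ c : ℝ, 0 < c → c ^ (-α) = (c ^ (-(α / 2))) ^ 2 := fun c hc ↦ by
    rw [sq, ← rpow_add hc]; ring_nf
  refine Real.sqrt_le_iff.2 ⟨by positivity, ?_⟩
  calc s * t ≤ (K * a ^ (-α)) * (K * b ^ (-α)) := by gcongr
    _ = (K * (a ^ (-(α / 2)) * b ^ (-(α / 2)))) ^ 2 := by rw [hsq a ha, hsq b hb]; ring

/-- Polynomial decay of the Hellinger affinity for location families with
power-like tails: if a probability density `p` on `ℝ` satisfies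
`p u ≤ K (1+|u|)^{−α}` with `α > 1`, then for every `γ ∈ (0, min(α/2, α−1))`
there is a constant `C` such that for all `θ, θ0` with `|θ − θ0| ≥ 1`,
`∫ √(p(x−θ) p(x−θ0)) dx ≤ C |θ − θ0|^{−γ}`; in particular, the location family
`p_θ(x) := p(x−θ)` satisfies condition (D1). -/
theorem location_family_hellinger_affinity_decay
    (p : ℝ → ℝ) (hpmeas : Measurable p) (hpnn : ∀ u, 0 ≤ p u)
    (hpint : (∫ u, p u) = 1)
    (K α : ℝ) (hα : 1 < α)
    (hptail : ∀ u : ℝ, p u ≤ K * (1 + |u|) ^ (-α)) :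
    ∀ γ : ℝ, 0 < γ → γ < min (α / 2) (α - 1) →
      ∃ C : ℝ, ∀ θ θ0 : ℝ, 1 ≤ |θ - θ0| →
        (∫ x, Real.sqrt (p (x - θ) * p (x - θ0))) ≤ C * |θ - θ0| ^ (-γ) := by
  intro γ hγ hγmin
  obtain ⟨hγα, hγα'⟩ := lt_min_iff.1 hγmin
  have hK : 0 ≤ K := by simpa using (hpnn 0).trans (hptail 0)
  let g : ℝ → ℝ := fun u ↦ (1 + |u|) ^ (-(α - γ))
  have hg : Integrable g := by
    simpa [g] using integrable_one_add_norm (E := ℝ) (μ := volume) (r := α - γ)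
      (by simp; linarith)
  refine ⟨K * (2 ^ γ * (2 * ∫ u, g u)), fun θ θ0 hθ ↦ ?_⟩
  have hΔ : 0 < |θ - θ0| := by linarith
  have hbound : ∀ x, √(p (x - θ) * p (x - θ0)) ≤
      K * ((|θ - θ0| / 2) ^ (-γ) * (g (x - θ) + g (x - θ0))) := fun x ↦ by
    have htri : |θ - θ0| ≤ (1 + |x - θ|) + (1 + |x - θ0|) := by
      have := abs_sub_le θ x θ0
      rw [abs_sub_comm θ x] at this
      linarith
    exact (sqrt_mul_le_of_le_mul_rpow (hpnn _) hK (by positivity) (by positivity)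
      (hptail _) (hptail _)).trans (mul_le_mul_of_nonneg_left
        (rpow_mul_rpow_le_add (by positivity) (by positivity) hΔ htri hγ.le hγα.le) hK)
  have hgθ := hg.comp_sub_right θ
  have hgθ0 := hg.comp_sub_right θ0
  calc ∫ x, √(p (x - θ) * p (x - θ0))
      ≤ ∫ x, K * ((|θ - θ0| / 2) ^ (-γ) * (g (x - θ) + g (x - θ0))) :=
        integral_mono_of_nonneg (.of_forall fun _ ↦ Real.sqrt_nonneg _)
          (((hgθ.add hgθ0).const_mul _).const_mul _) (.of_forall hbound)
    _ = K * ((|θ - θ0| / 2) ^ (-γ) * (2 * ∫ u, g u)) := by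
        rw [integral_const_mul, integral_const_mul, integral_add hgθ hgθ0,
          integral_sub_right_eq_self g, integral_sub_right_eq_self g, two_mul]
    _ = K * (2 ^ γ * (2 * ∫ u, g u)) * |θ - θ0| ^ (-γ) := by
        rw [div_rpow hΔ.le zero_le_two, rpow_neg zero_le_two, div_inv_eq_mul]
        ring
end

section
/- Let Θ and 𝒳 be open intervals in ℝ, let μ be Lebesgue measure on 𝒳, and let (p_θ)_{θ∈Θ} be a family of probability densities on 𝒳 with p_θ(x) > 0 for all (x,θ) ∈ 𝒳×Θ. Write ℓ(x,θ) := log p_θ(x) and let X, X₁, X₂, … be i.i.d. with density p_θ under P_θ for each θ ∈ Θ. Assume: (iv) ℓ has continuous partial derivatives in x and θ up to total order 4 on 𝒳×Θ; (v) the Fisher information I(θ) = −E_θ ℓ″_{θθ}(X,θ) is everywhere finite, nowhere zero, and continuous on Θ; (vi) for each θ ∈ Θ there is ε_θ > 0 such that either E_θ sup_{τ∈[θ−ε_θ,θ+ε_θ]} |ℓ‴_{θθθ}(X,τ)| < ∞ or E_θ |X|^{δ_θ} sup_{τ∈[θ−ε_θ,θ+ε_θ]} |ℓ″_{θθ}(X,τ)|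 < ∞ for some δ_θ > 0; (vii) E_θ ℓ‴_{θθθ}(X,θ) and E_θ ℓ‴_{xθθ}(X,θ) exist in ℝ and are continuous in θ; (viii) for each θ ∈ Θ there is ε_θ > 0 such that either E_θ sup_{τ∈[θ−ε_θ,θ+ε_θ]} |ℓ⁗_{θθθθ}(X,τ)| < ∞ or E_θ |X|^{δ_θ} sup_{τ∈[θ−ε_θ,θ+ε_θ]} |ℓ‴_{θθθ}(X,τ)| < ∞ for some δ_θ > 0; (ix) for each n and each x = (x₁,…,x_n) ∈ 𝒳ⁿ the MLE value θ̂_n(x) lies in Θ and satisfies ∑_{i=1}^n ℓ′_θ(x_i, θ̂_n(x)) = 0; (x) θ̂_n(X₁,…,X_n) is consistent: for each θ ∈ Θ it converges to θ in P_θ-probability. Assume finally that there exist a twice continuously differentiable function q : Θ → ℝ with q′(θ) ≠ 0 for all θ ∈ Θ, a Borel function g : 𝒳 → ℝ, and Borel sets E_n ⊆ ℝⁿ with P_θ((X₁,…,X_n) ∉ E_n) → 0 as n → ∞ for each θ ∈ Θ, such that for each n and each x ∈ E_n one has θ̂_n(x) ∈ Θ and q(θ̂_n(x)) = (1/n) ∑_{i=1}^n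 g(x_i). Then the family (p_θ)_{θ∈Θ} is a one-parameter exponential family: there exist functions w, c on Θ and T, h on 𝒳 such that ℓ(x,θ) = w(θ) T(x) + c(θ) + h(x) for all (x,θ) ∈ 𝒳×Θ. -/
open MeasureTheory ProbabilityTheory Real Filter

theorem sub_le_setIntegral_abs_logDeriv {F S : ℝ → ℝ} {a b : ℝ}
    (hF : ∀ t ∈ Set.Icc a b, HasDerivAt F (F t * S t) t) (hS : ContinuousOn S (Set.Icc a b))
    {s t : ℝ} (hs : s ∈ Set.Icc a b) (ht : t ∈ Set.Icc a b) :
    F s - F t ≤ ∫ u in Set.Icc a b, |F u * S u| := by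
  have hFc : ContinuousOn F (Set.Icc a b) := fun u hu => (hF u hu).continuousAt.continuousWithinAt
  have hc : ContinuousOn (fun u => F u * S u) (Set.Icc a b) := hFc.mul hS
  have hsub : Set.uIcc t s ⊆ Set.Icc a b := Set.uIcc_subset_Icc ht hs
  have h1 : ∫ u in t..s, F u * S u = F s - F t :=
    intervalIntegral.integral_eq_sub_of_hasDerivAt (fun u hu => hF u (hsub hu))
      (hc.mono hsub).intervalIntegrable
  rw [← h1]
  calc ∫ u in t..s, F u * S u ≤ ‖∫ u in t..s, F u * S u‖ := le_abs_self _
    _ ≤ ∫ u in Set.uIoc t s, ‖F u * S u‖ := intervalIntegral.norm_integral_le_integral_norm_uIoc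
    _ ≤ ∫ u in Set.Icc a b, |F u * S u| := by
        refine setIntegral_mono_set ?_ ?_ ?_
        · exact hc.abs.integrableOn_Icc
        · exact Eventually.of_forall fun u => abs_nonneg _
        · exact (Set.uIoc_subset_uIcc.trans hsub).eventuallyLE

theorem setIntegral_abs_logDeriv_le {F S : ℝ → ℝ} {a b : ℝ} (hab : a < b)
    (hF : ∀ t ∈ Set.Icc a b, HasDerivAt F (F t * S t) t) (hS : ContinuousOn S (Set.Icc a b))
    (hpos : ∀ t ∈ Set.Icc a b, 0 ≤ F t) :
    ∫ u in Set.Icc a b, |F u * S u| ≤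
      1 / (2 * (b - a)) * (∫ u in Set.Icc a b, F u)
        + (b - a) / 2 * ∫ u in Set.Icc a b, F u * S u ^ 2 := by
  have hFc : ContinuousOn F (Set.Icc a b) := fun u hu => (hF u hu).continuousAt.continuousWithinAt
  have hk : 0 < b - a := sub_pos.2 hab
  rw [← integral_const_mul, ← integral_const_mul, ← integral_add]
  · refine setIntegral_mono_on (hFc.mul hS).abs.integrableOn_Icc ?_ measurableSet_Icc ?_
    · exact ContinuousOn.integrableOn_Icc (by fun_prop)
    · intro u hu
      rw [abs_mul, abs_of_nonneg (hpos u hu)]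
      have h2 : |S u| ≤ 1 / (2 * (b - a)) + (b - a) / 2 * S u ^ 2 := by
        have : 1 / (2 * (b - a)) + (b - a) / 2 * S u ^ 2 - |S u|
            = (1 - (b - a) * |S u|) ^ 2 / (2 * (b - a)) := by
          rw [← sq_abs (S u)]; field_simp; ring
        have h3 : 0 ≤ (1 - (b - a) * |S u|) ^ 2 / (2 * (b - a)) := by positivity
        linarith
      have := mul_le_mul_of_nonneg_left h2 (hpos u hu)
      linarith
  · exact ContinuousOn.integrableOn_Icc (by fun_prop)
  · exact ContinuousOn.integrableOn_Icc (by fun_prop)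

theorem ofReal_le_setLIntegral_logDeriv_sq {F S : ℝ → ℝ} {a b c : ℝ} (hab : a < b)
    (hF : ∀ t ∈ Set.Icc a b, HasDerivAt F (F t * S t) t) (hS : ContinuousOn S (Set.Icc a b))
    (hpos : ∀ t ∈ Set.Icc a b, 0 ≤ F t) (hc : c ∈ Set.Icc a b) :
    ENNReal.ofReal (F c) ≤
      ∫⁻ t in Set.Icc a b, ENNReal.ofReal (F t * (2 / (b - a) + (b - a) * S t ^ 2)) := by
  have hFc : ContinuousOn F (Set.Icc a b) := fun u hu => (hF u hu).continuousAt.continuousWithinAt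
  have hk : 0 < b - a := sub_pos.2 hab
  have i1 : IntegrableOn F (Set.Icc a b) := hFc.integrableOn_Icc
  have i2 : IntegrableOn (fun u => F u * S u ^ 2) (Set.Icc a b) :=
    ContinuousOn.integrableOn_Icc (by fun_prop)
  have n1 : 0 ≤ ∫ u in Set.Icc a b, F u := setIntegral_nonneg measurableSet_Icc hpos
  have n2 : 0 ≤ ∫ u in Set.Icc a b, F u * S u ^ 2 :=
    setIntegral_nonneg measurableSet_Icc fun u hu => mul_nonneg (hpos u hu) (sq_nonneg _)
  have hA := setIntegral_abs_logDeriv_le hab hF hS hpos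
  have hB : (b - a) * (F c - ∫ u in Set.Icc a b, |F u * S u|) ≤ ∫ u in Set.Icc a b, F u := by
    have : ∫ u in Set.Icc a b, (F c - ∫ u in Set.Icc a b, |F u * S u|)
        = (b - a) * (F c - ∫ u in Set.Icc a b, |F u * S u|) := by
      simp [hab.le]
    rw [← this]
    refine setIntegral_mono_on (by simp) i1 measurableSet_Icc fun t ht => ?_
    linarith [sub_le_setIntegral_abs_logDeriv hF hS hc ht]
  rw [← ofReal_integral_eq_lintegral_ofReal]
  · apply ENNReal.ofReal_le_ofReal
    have hC : ∫ t in Set.Icc a b, F t * (2 / (b - a) + (b - a) * S t ^ 2)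
        = 2 / (b - a) * (∫ u in Set.Icc a b, F u)
          + (b - a) * ∫ u in Set.Icc a b, F u * S u ^ 2 := by
      rw [← integral_const_mul, ← integral_const_mul, ← integral_add (i1.const_mul _) (i2.const_mul _)]
      congr 1; ext u; ring
    rw [hC]
    have hD : F c ≤ 1 / (b - a) * (∫ u in Set.Icc a b, F u) + ∫ u in Set.Icc a b, |F u * S u| := by
      have := (le_div_iff₀' hk).2 hB
      rw [one_div, inv_mul_eq_div]; linarith
    have e1 : 2 / (b - a) * (∫ u in Set.Icc a b, F u) - 1 / (b - a) * (∫ u in Set.Icc a b, F u) -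
        1 / (2 * (b - a)) * (∫ u in Set.Icc a b, F u) = 1 / (2 * (b - a)) * (∫ u in Set.Icc a b, F u) := by
      field_simp; ring
    have e2 : 0 ≤ 1 / (2 * (b - a)) * (∫ u in Set.Icc a b, F u) := by positivity
    have e3 : 0 ≤ (b - a) * ∫ u in Set.Icc a b, F u * S u ^ 2 := by positivity
    linarith
  · exact ContinuousOn.integrableOn_Icc (by fun_prop)
  · refine (ae_restrict_mem measurableSet_Icc).mono fun u hu => ?_
    have := hpos u hu
    simp only [Pi.zero_apply]; positivity

theorem comparable_or_ofReal_le_setLIntegral_logDeriv_sq {F S : ℝ → ℝ} {a b c : ℝ} (hab : a < b)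
    (hF : ∀ t ∈ Set.Icc a b, HasDerivAt F (F t * S t) t) (hS : ContinuousOn S (Set.Icc a b))
    (hpos : ∀ t ∈ Set.Icc a b, 0 ≤ F t) (hc : c ∈ Set.Icc a b) :
    (∀ s ∈ Set.Icc a b, F c ≤ 4 * F s) ∨
      ENNReal.ofReal (F c) ≤ ∫⁻ t in Set.Icc a b, ENNReal.ofReal (2 * (b - a) * (F t * S t ^ 2)) := by
  rw [or_iff_not_imp_left]
  intro hne
  push Not at hne
  obtain ⟨s, hs, hsc⟩ := hne
  have hFc : ContinuousOn F (Set.Icc a b) := fun u hu => (hF u hu).continuousAt.continuousWithinAt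
  have hk : 0 < b - a := sub_pos.2 hab
  obtain ⟨m, hm, hmax⟩ := isCompact_Icc.exists_isMaxOn (Set.nonempty_Icc.2 hab.le) hFc
  have i1 : IntegrableOn F (Set.Icc a b) := hFc.integrableOn_Icc
  have i2 : IntegrableOn (fun u => F u * S u ^ 2) (Set.Icc a b) :=
    ContinuousOn.integrableOn_Icc (by fun_prop)
  have hcm : F c ≤ F m := hmax hc
  have hA := setIntegral_abs_logDeriv_le hab hF hS hpos
  have hB := sub_le_setIntegral_abs_logDeriv hF hS hm hs
  have hI : ∫ u in Set.Icc a b, F u ≤ (b - a) * F m := by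
    have : ∫ u in Set.Icc a b, F m = (b - a) * F m := by simp [hab.le]
    rw [← this]
    exact setIntegral_mono_on i1 (by simp) measurableSet_Icc fun t ht => hmax ht
  have hI2 : 1 / (2 * (b - a)) * (∫ u in Set.Icc a b, F u) ≤ F m / 2 := by
    calc _ ≤ 1 / (2 * (b - a)) * ((b - a) * F m) := by gcongr
      _ = _ := by field_simp
  rw [← ofReal_integral_eq_lintegral_ofReal (i2.const_mul _), integral_const_mul]
  · apply ENNReal.ofReal_le_ofReal
    linarith
  · refine (ae_restrict_mem measurableSet_Icc).mono fun u hu => ?_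
    have := hpos u hu
    simp only [Pi.zero_apply]; positivity

theorem setLIntegral_logDeriv_sq_le {F S S2 : ℝ → ℝ} {c r : ℝ} (hr : 0 < r)
    (hF : ∀ t ∈ Set.Icc (c - r) (c + r), HasDerivAt F (F t * S t) t)
    (hS : ∀ t ∈ Set.Icc (c - r) (c + r), HasDerivAt S (S2 t) t)
    (hS2 : ContinuousOn S2 (Set.Icc (c - r) (c + r)))
    (hpos : ∀ t ∈ Set.Icc (c - r) (c + r), 0 ≤ F t) :
    ∫⁻ t in Set.Icc (c - r / 2) (c + r / 2), ENNReal.ofReal (F t * S t ^ 2) ≤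
      ∫⁻ t in Set.Icc (c - r) (c + r), ENNReal.ofReal (2 * (F t * (8 / r ^ 2 + |S2 t|))) := by
  have hFc : ContinuousOn F (Set.Icc (c - r) (c + r)) :=
    fun u hu => (hF u hu).continuousAt.continuousWithinAt
  have hSc : ContinuousOn S (Set.Icc (c - r) (c + r)) :=
    fun u hu => (hS u hu).continuousAt.continuousWithinAt
  set φ : ℝ → ℝ := fun t => (1 - ((t - c) / r) ^ 2) ^ 2 with hφ
  set φ1 : ℝ → ℝ := fun t => -4 * ((t - c) / r) * (1 - ((t - c) / r) ^ 2) / r with hφ1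
  set φ2 : ℝ → ℝ := fun t => (-4 + 12 * ((t - c) / r) ^ 2) / r ^ 2 with hφ2
  have d0 : ∀ t, HasDerivAt (fun t => (t - c) / r) (1 / r) t := fun t =>
    ((hasDerivAt_id t).sub_const c).div_const r
  have d1 : ∀ t, HasDerivAt φ (φ1 t) t := by
    intro t
    have h : HasDerivAt φ _ t := (((d0 t).pow 2).const_sub 1).pow 2
    refine h.congr_deriv ?_
    simp only [hφ1, Pi.pow_apply]; push_cast; ring
  have d2 : ∀ t, HasDerivAt φ1 (φ2 t) t := by
    intro t
    have h : HasDerivAt φ1 _ t :=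
      (((d0 t).const_mul (-4)).mul ((((d0 t).pow 2).const_sub 1))).div_const r
    refine h.congr_deriv ?_
    simp only [hφ2, Pi.pow_apply]; push_cast; field_simp; ring
  have hφc : Continuous φ := by fun_prop
  have hcontφ : Continuous φ2 := by fun_prop
  have hcr : c - r ≤ c + r := by linarith
  have key : ∫ t in (c - r)..(c + r), (φ t * (F t * (S2 t + S t ^ 2)) - φ2 t * F t) = 0 := by
    have hd : ∀ t ∈ Set.uIcc (c - r) (c + r),
        HasDerivAt (fun t => φ t * (F t * S t) - φ1 t * F t)
          (φ t * (F t * (S2 t + S t ^ 2)) - φ2 t * F t) t := by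
      intro t ht
      rw [Set.uIcc_of_le hcr] at ht
      have h : HasDerivAt (fun t => φ t * (F t * S t) - φ1 t * F t) _ t :=
        ((d1 t).mul ((hF t ht).mul (hS t ht))).sub ((d2 t).mul (hF t ht))
      refine h.congr_deriv ?_
      simp only [Pi.mul_apply]; ring
    rw [intervalIntegral.integral_eq_sub_of_hasDerivAt hd]
    · have h1 : (r / r) = 1 := div_self hr.ne'
      have h2 : (-r / r) = -1 := by rw [neg_div, h1]
      simp [hφ, hφ1, h1, h2]
    · apply ContinuousOn.intervalIntegrable
      rw [Set.uIcc_of_le hcr]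
      fun_prop
  rw [intervalIntegral.integral_of_le hcr, ← integral_Icc_eq_integral_Ioc] at key
  have iA : IntegrableOn (fun t => φ t * (F t * S t ^ 2)) (Set.Icc (c - r) (c + r)) :=
    ContinuousOn.integrableOn_Icc (by fun_prop)
  have iB : IntegrableOn (fun t => F t * (8 / r ^ 2 + |S2 t|)) (Set.Icc (c - r) (c + r)) :=
    ContinuousOn.integrableOn_Icc (by fun_prop)
  have iC : IntegrableOn (fun t => φ t * (F t * (S2 t + S t ^ 2)) - φ2 t * F t)
      (Set.Icc (c - r) (c + r)) :=
    ContinuousOn.integrableOn_Icc (by fun_prop)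
  have hsq : ∀ t ∈ Set.Icc (c - r) (c + r), ((t - c) / r) ^ 2 ≤ 1 := by
    intro t ht
    rw [sq_le_one_iff_abs_le_one, abs_div, abs_of_pos hr, div_le_one hr, abs_le]
    constructor <;> linarith [ht.1, ht.2]
  have main : ∫ t in Set.Icc (c - r) (c + r), φ t * (F t * S t ^ 2) ≤
      ∫ t in Set.Icc (c - r) (c + r), F t * (8 / r ^ 2 + |S2 t|) := by
    have : ∫ t in Set.Icc (c - r) (c + r), φ t * (F t * S t ^ 2) =
        ∫ t in Set.Icc (c - r) (c + r), (φ t * (F t * S t ^ 2) -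
          (φ t * (F t * (S2 t + S t ^ 2)) - φ2 t * F t)) := by
      rw [integral_sub iA iC, key, sub_zero]
    rw [this]
    refine setIntegral_mono_on (iA.sub iC) iB measurableSet_Icc fun t ht => ?_
    have hu := hsq t ht
    have hF0 := hpos t ht
    have hu0 : 0 ≤ ((t - c) / r) ^ 2 := sq_nonneg _
    have b2 : φ2 t ≤ 8 / r ^ 2 := by
      simp only [hφ2]; gcongr; linarith
    have b0 : 0 ≤ φ t := sq_nonneg _
    have b1 : φ t ≤ 1 := by
      simp only [hφ]; nlinarith
    have b3 : -(φ t * S2 t) ≤ |S2 t| := by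
      calc -(φ t * S2 t) ≤ |φ t * S2 t| := neg_le_abs _
        _ = φ t * |S2 t| := by rw [abs_mul, abs_of_nonneg b0]
        _ ≤ 1 * |S2 t| := by gcongr
        _ = _ := one_mul _
    have : φ t * (F t * S t ^ 2) - (φ t * (F t * (S2 t + S t ^ 2)) - φ2 t * F t)
        = F t * (φ2 t + -(φ t * S2 t)) := by ring
    rw [this]
    gcongr
  have hsub : Set.Icc (c - r / 2) (c + r / 2) ⊆ Set.Icc (c - r) (c + r) :=
    Set.Icc_subset_Icc (by linarith) (by linarith)
  calc ∫⁻ t in Set.Icc (c - r / 2) (c + r / 2), ENNReal.ofReal (F t * S t ^ 2)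
      ≤ ∫⁻ t in Set.Icc (c - r / 2) (c + r / 2), ENNReal.ofReal (2 * (φ t * (F t * S t ^ 2))) := by
        refine setLIntegral_mono' measurableSet_Icc fun t ht => ENNReal.ofReal_le_ofReal ?_
        have hF0 := hpos t (hsub ht)
        have hu : ((t - c) / r) ^ 2 ≤ 1 / 4 := by
          have : |(t - c) / r| ≤ 1 / 2 := by
            rw [abs_div, abs_of_pos hr, div_le_iff₀ hr, abs_le]
            constructor <;> linarith [ht.1, ht.2]
          rw [← sq_abs]; nlinarith [abs_nonneg ((t - c) / r)]
        have hb : 1 / 2 ≤ φ t := by simp only [hφ]; nlinarith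
        have h0 : 0 ≤ F t * S t ^ 2 := by positivity
        nlinarith
    _ ≤ ∫⁻ t in Set.Icc (c - r) (c + r), ENNReal.ofReal (2 * (φ t * (F t * S t ^ 2))) :=
        lintegral_mono_set hsub
    _ ≤ _ := by
        rw [← ofReal_integral_eq_lintegral_ofReal (iA.const_mul 2),
          ← ofReal_integral_eq_lintegral_ofReal (iB.const_mul 2), integral_const_mul,
          integral_const_mul]
        · exact ENNReal.ofReal_le_ofReal (by linarith)
        · refine (ae_restrict_mem measurableSet_Icc).mono fun u hu => ?_
          have := hpos u hu
          simp only [Pi.zero_apply]; positivity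
        · refine (ae_restrict_mem measurableSet_Icc).mono fun u hu => ?_
          have := hpos u hu
          simp only [Pi.zero_apply]; positivity

theorem lintegral_fin_prod_eq_prod_lintegral {α : Type*} [MeasurableSpace α] (μ : Measure α)
    [SigmaFinite μ] : ∀ {n : ℕ} (φ : Fin n → α → ENNReal) (_ : ∀ i, Measurable (φ i)),
    ∫⁻ x, ∏ i, φ i (x i) ∂(Measure.pi fun _ : Fin n => μ) = ∏ i, ∫⁻ y, φ i y ∂μ
  | 0, φ, _ => by simp
  | n + 1, φ, hφ => by
    have hm : Measurable fun y : Fin n → α => ∏ i : Fin n, φ i.succ (y i) :=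
      Finset.measurable_fun_prod _ fun i _ => (hφ _).comp (measurable_pi_apply i)
    rw [Fin.prod_univ_succ, ← lintegral_fin_prod_eq_prod_lintegral μ (fun i => φ i.succ)
      (fun i => hφ _), ← lintegral_prod_mul (hφ 0).aemeasurable hm.aemeasurable,
      ← ((measurePreserving_piFinSuccAbove (fun _ : Fin (n + 1) => μ) 0).symm).lintegral_comp_emb
        (MeasurableEquiv.measurableEmbedding _)]
    refine lintegral_congr fun z => ?_
    rw [Fin.prod_univ_succ]
    rfl

theorem pi_withDensity_eq {α : Type*} [MeasurableSpace α] (μ : Measure α) [SigmaFinite μ]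
    {φ : α → ENNReal} (hφ : Measurable φ) [SigmaFinite (μ.withDensity φ)] (n : ℕ) :
    (Measure.pi fun _ : Fin n => μ.withDensity φ) =
      (Measure.pi fun _ : Fin n => μ).withDensity fun x => ∏ i, φ (x i) := by
  refine Measure.pi_eq fun s hs => ?_
  rw [withDensity_apply _ (MeasurableSet.univ_pi hs), ← lintegral_indicator (MeasurableSet.univ_pi hs)]
  have h : ∀ x : Fin n → α, (Set.univ.pi s).indicator (fun x => ∏ i, φ (x i)) x =
      ∏ i, (s i).indicator φ (x i) := by
    intro x
    by_cases hx : x ∈ Set.univ.pi s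
    · rw [Set.indicator_of_mem hx]
      exact Finset.prod_congr rfl fun i _ => (Set.indicator_of_mem (hx i trivial) _).symm
    · rw [Set.indicator_of_notMem hx]
      simp only [Set.mem_univ_pi, not_forall] at hx
      obtain ⟨i, hi⟩ := hx
      exact (Finset.prod_eq_zero (Finset.mem_univ i) (Set.indicator_of_notMem hi _)).symm
  simp_rw [h]
  rw [lintegral_fin_prod_eq_prod_lintegral μ _ fun i => hφ.indicator (hs i)]
  exact Finset.prod_congr rfl fun i _ => by
    rw [lintegral_indicator (hs i), withDensity_apply _ (hs i)]

theorem lintegral_pi_sum_eval {α : Type*} [MeasurableSpace α] (μ : Measure α)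
    [IsProbabilityMeasure μ] (n : ℕ) {ψ : α → ENNReal} (hψ : Measurable ψ) :
    ∫⁻ x, ∑ i, ψ (x i) ∂(Measure.pi fun _ : Fin n => μ) = n * ∫⁻ y, ψ y ∂μ := by
  have hm : ∀ i : Fin n, Measurable fun x : Fin n → α => ψ (x i) :=
    fun i => hψ.comp (measurable_pi_apply i)
  rw [lintegral_finsetSum _ fun i _ => hm i]
  have : ∀ i : Fin n, ∫⁻ x, ψ (x i) ∂(Measure.pi fun _ : Fin n => μ) = ∫⁻ y, ψ y ∂μ :=
    fun i => (measurePreserving_eval (fun _ : Fin n => μ) i).lintegral_comp hψ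
  simp [this]

/-- A family of positive probability densities `f · t` on `𝒳`, indexed by the open set `Θ`, whose
log-likelihood has successive parameter derivatives `l1`, `l2`, `l3`. -/
structure IsLogDerivFamily (𝒳 Θ : Set ℝ) (f l1 l2 l3 : ℝ → ℝ → ℝ) : Prop where
  measurableSet : MeasurableSet 𝒳
  measurable_density : Measurable (Function.uncurry f)
  measurable_one : Measurable (Function.uncurry l1)
  measurable_two : Measurable (Function.uncurry l2)
  measurable_three : Measurable (Function.uncurry l3)
  pos : ∀ x ∈ 𝒳, ∀ t ∈ Θ, 0 < f x t
  hasDerivAt_density : ∀ x ∈ 𝒳, ∀ t ∈ Θ, HasDerivAt (f x) (f x t * l1 x t) t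
  hasDerivAt_one : ∀ x ∈ 𝒳, ∀ t ∈ Θ, HasDerivAt (l1 x) (l2 x t) t
  hasDerivAt_two : ∀ x ∈ 𝒳, ∀ t ∈ Θ, HasDerivAt (l2 x) (l3 x t) t
  continuousOn_three : ∀ x ∈ 𝒳, ContinuousOn (l3 x) Θ
  lintegral_eq_one : ∀ t ∈ Θ, ∫⁻ x in 𝒳, ENNReal.ofReal (f x t) = 1

/-- The measure on `𝒳` with density `f · t`. -/
noncomputable def densityMeasure (𝒳 : Set ℝ) (f : ℝ → ℝ → ℝ) (t : ℝ) : Measure ℝ :=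
  (volume.restrict 𝒳).withDensity fun x => ENNReal.ofReal (f x t)

namespace IsLogDerivFamily

variable {𝒳 Θ : Set ℝ} {f l1 l2 l3 : ℝ → ℝ → ℝ}

theorem isProbabilityMeasure (hf : IsLogDerivFamily 𝒳 Θ f l1 l2 l3) {t : ℝ} (ht : t ∈ Θ) :
    IsProbabilityMeasure (densityMeasure 𝒳 f t) := by
  constructor
  rw [densityMeasure, withDensity_apply _ MeasurableSet.univ, Measure.restrict_univ,
    hf.lintegral_eq_one t ht]

theorem measurable_density_left (hf : IsLogDerivFamily 𝒳 Θ f l1 l2 l3) (t : ℝ) :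
    Measurable fun x => ENNReal.ofReal (f x t) :=
  ENNReal.measurable_ofReal.comp (hf.measurable_density.comp (measurable_id.prodMk measurable_const))

theorem lintegral_densityMeasure (hf : IsLogDerivFamily 𝒳 Θ f l1 l2 l3) (t : ℝ)
    {ψ : ℝ → ENNReal} (hψ : Measurable ψ) :
    ∫⁻ x, ψ x ∂densityMeasure 𝒳 f t = ∫⁻ x in 𝒳, ENNReal.ofReal (f x t) * ψ x := by
  rw [densityMeasure, lintegral_withDensity_eq_lintegral_mul _ (hf.measurable_density_left t) hψ]
  rfl

theorem pi_densityMeasure (hf : IsLogDerivFamily 𝒳 Θ f l1 l2 l3) {t : ℝ} (ht : t ∈ Θ) (n : ℕ) :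
    (Measure.pi fun _ : Fin n => densityMeasure 𝒳 f t) =
      (Measure.pi fun _ : Fin n => volume.restrict 𝒳).withDensity
        fun x => ∏ i, ENNReal.ofReal (f (x i) t) := by
  have := hf.isProbabilityMeasure ht
  unfold densityMeasure at this ⊢
  exact pi_withDensity_eq _ (hf.measurable_density_left t) n

theorem ae_mem (hf : IsLogDerivFamily 𝒳 Θ f l1 l2 l3) (n : ℕ) :
    ∀ᵐ x ∂(Measure.pi fun _ : Fin n => volume.restrict 𝒳), ∀ i, x i ∈ 𝒳 := by
  rw [ae_all_iff]
  intro i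
  exact (Measure.quasiMeasurePreserving_eval (fun _ : Fin n => volume.restrict 𝒳) i).ae
    (ae_restrict_mem hf.measurableSet)

theorem measurable_eval_one (hf : IsLogDerivFamily 𝒳 Θ f l1 l2 l3) {n : ℕ} (i : Fin n) :
    Measurable fun z : (Fin n → ℝ) × ℝ => l1 (z.1 i) z.2 := by
  have h : Measurable fun z : (Fin n → ℝ) × ℝ => (z.1 i, z.2) := by fun_prop
  exact hf.measurable_one.comp h

theorem measurable_eval_two (hf : IsLogDerivFamily 𝒳 Θ f l1 l2 l3) {n : ℕ} (i : Fin n) :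
    Measurable fun z : (Fin n → ℝ) × ℝ => l2 (z.1 i) z.2 := by
  have h : Measurable fun z : (Fin n → ℝ) × ℝ => (z.1 i, z.2) := by fun_prop
  exact hf.measurable_two.comp h

theorem measurable_eval_density (hf : IsLogDerivFamily 𝒳 Θ f l1 l2 l3) {n : ℕ} (i : Fin n) :
    Measurable fun z : (Fin n → ℝ) × ℝ => f (z.1 i) z.2 := by
  have h : Measurable fun z : (Fin n → ℝ) × ℝ => (z.1 i, z.2) := by fun_prop
  exact hf.measurable_density.comp h

theorem hasDerivAt_prod (hf : IsLogDerivFamily 𝒳 Θ f l1 l2 l3) {n : ℕ} {x : Fin n → ℝ}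
    (hx : ∀ i, x i ∈ 𝒳) {t : ℝ} (ht : t ∈ Θ) :
    HasDerivAt (fun t => ∏ i, f (x i) t) ((∏ i, f (x i) t) * ∑ i, l1 (x i) t) t := by
  have h := HasDerivAt.fun_finsetProd (u := Finset.univ) (f := fun i => f (x i)) (x := t)
    (fun i _ => hf.hasDerivAt_density (x i) (hx i) t ht)
  refine h.congr_deriv ?_
  rw [Finset.mul_sum]
  refine Finset.sum_congr rfl fun i _ => ?_
  rw [smul_eq_mul, ← mul_assoc, Finset.prod_erase_mul _ _ (Finset.mem_univ i)]

theorem hasDerivAt_sum (hf : IsLogDerivFamily 𝒳 Θ f l1 l2 l3) {n : ℕ} {x : Fin n → ℝ}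
    (hx : ∀ i, x i ∈ 𝒳) {t : ℝ} (ht : t ∈ Θ) :
    HasDerivAt (fun t => ∑ i, l1 (x i) t) (∑ i, l2 (x i) t) t :=
  HasDerivAt.fun_sum fun i _ => hf.hasDerivAt_one (x i) (hx i) t ht

theorem prod_pos (hf : IsLogDerivFamily 𝒳 Θ f l1 l2 l3) {n : ℕ} {x : Fin n → ℝ}
    (hx : ∀ i, x i ∈ 𝒳) {t : ℝ} (ht : t ∈ Θ) : 0 < ∏ i, f (x i) t :=
  Finset.prod_pos fun i _ => hf.pos (x i) (hx i) t ht

theorem prod_ofReal (hf : IsLogDerivFamily 𝒳 Θ f l1 l2 l3) {n : ℕ} {x : Fin n → ℝ}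
    (hx : ∀ i, x i ∈ 𝒳) {t : ℝ} (ht : t ∈ Θ) :
    ∏ i, ENNReal.ofReal (f (x i) t) = ENNReal.ofReal (∏ i, f (x i) t) :=
  (ENNReal.ofReal_prod_of_nonneg fun i _ => (hf.pos (x i) (hx i) t ht).le).symm

theorem lintegral_pi_densityMeasure (hf : IsLogDerivFamily 𝒳 Θ f l1 l2 l3) {t : ℝ} (ht : t ∈ Θ)
    {n : ℕ} {ψ : (Fin n → ℝ) → ENNReal} (hψ : Measurable ψ) :
    ∫⁻ x, ψ x ∂(Measure.pi fun _ : Fin n => densityMeasure 𝒳 f t) =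
      ∫⁻ x, ENNReal.ofReal (∏ i, f (x i) t) * ψ x
        ∂(Measure.pi fun _ : Fin n => volume.restrict 𝒳) := by
  have hm : Measurable fun x : Fin n → ℝ => ∏ i, ENNReal.ofReal (f (x i) t) :=
    Finset.measurable_fun_prod _ fun i _ =>
      (hf.measurable_density_left t).comp (measurable_pi_apply i)
  rw [hf.pi_densityMeasure ht, lintegral_withDensity_eq_lintegral_mul _ hm hψ]
  refine lintegral_congr_ae ((hf.ae_mem n).mono fun x hx => ?_)
  simp only [Pi.mul_apply]
  rw [hf.prod_ofReal hx ht]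

/-- Expected squared score of a sample, integrated over a parameter interval, in terms of the
expected second derivative. -/
theorem setLIntegral_score_sq_le (hf : IsLogDerivFamily 𝒳 Θ f l1 l2 l3) {c r : ℝ} (hr : 0 < r)
    (hsub : Set.Icc (c - r) (c + r) ⊆ Θ) {M : ENNReal}
    (hM : ∀ t ∈ Set.Icc (c - r) (c + r),
      ∫⁻ x, ENNReal.ofReal |l2 x t| ∂densityMeasure 𝒳 f t ≤ M) (n : ℕ) :
    ∫⁻ t in Set.Icc (c - r / 2) (c + r / 2),
        ∫⁻ x, ENNReal.ofReal ((∑ i, l1 (x i) t) ^ 2)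
          ∂(Measure.pi fun _ : Fin n => densityMeasure 𝒳 f t) ≤
      2 * (ENNReal.ofReal (8 / r ^ 2) + n * M) * ENNReal.ofReal (2 * r) := by
  have hsub' : Set.Icc (c - r / 2) (c + r / 2) ⊆ Set.Icc (c - r) (c + r) :=
    Set.Icc_subset_Icc (by linarith) (by linarith)
  have hm1 : Measurable fun z : (Fin n → ℝ) × ℝ => ∑ i, l1 (z.1 i) z.2 :=
    Finset.measurable_fun_sum _ fun i _ => hf.measurable_eval_one i
  have hm2 : Measurable fun z : (Fin n → ℝ) × ℝ => ∑ i, l2 (z.1 i) z.2 :=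
    Finset.measurable_fun_sum _ fun i _ => hf.measurable_eval_two i
  have hm0 : Measurable fun z : (Fin n → ℝ) × ℝ => ∏ i, f (z.1 i) z.2 :=
    Finset.measurable_fun_prod _ fun i _ => hf.measurable_eval_density i
  have hs1 : ∀ t, Measurable fun x : Fin n → ℝ => ∑ i, l1 (x i) t := fun t =>
    hm1.comp (measurable_id.prodMk measurable_const)
  have hs2 : ∀ t, Measurable fun x : Fin n → ℝ => ∑ i, l2 (x i) t := fun t =>
    hm2.comp (measurable_id.prodMk measurable_const)
  calc ∫⁻ t in Set.Icc (c - r / 2) (c + r / 2), ∫⁻ x, ENNReal.ofReal ((∑ i, l1 (x i) t) ^ 2)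
          ∂(Measure.pi fun _ : Fin n => densityMeasure 𝒳 f t)
      = ∫⁻ t in Set.Icc (c - r / 2) (c + r / 2), ∫⁻ x : Fin n → ℝ,
          ENNReal.ofReal ((∏ i, f (x i) t) * (∑ i, l1 (x i) t) ^ 2)
          ∂(Measure.pi fun _ : Fin n => volume.restrict 𝒳) := by
        refine setLIntegral_congr_fun measurableSet_Icc fun t ht => ?_
        rw [hf.lintegral_pi_densityMeasure (hsub (hsub' ht))
          ((hs1 t).pow_const 2).ennreal_ofReal]
        refine lintegral_congr_ae ((hf.ae_mem n).mono fun x hx => ?_)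
        simp only
        rw [ENNReal.ofReal_mul (hf.prod_pos hx (hsub (hsub' ht))).le]
    _ = ∫⁻ x : Fin n → ℝ, (∫⁻ t in Set.Icc (c - r / 2) (c + r / 2),
          ENNReal.ofReal ((∏ i, f (x i) t) * (∑ i, l1 (x i) t) ^ 2))
          ∂(Measure.pi fun _ : Fin n => volume.restrict 𝒳) :=
        lintegral_lintegral_swap (by
          have : Measurable fun z : ℝ × (Fin n → ℝ) =>
              ENNReal.ofReal ((∏ i, f (z.2 i) z.1) * (∑ i, l1 (z.2 i) z.1) ^ 2) :=
            (hm0.mul (hm1.pow_const 2)).ennreal_ofReal.comp measurable_swap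
          exact this.aemeasurable)
    _ ≤ ∫⁻ x : Fin n → ℝ, (∫⁻ t in Set.Icc (c - r) (c + r),
          ENNReal.ofReal (2 * ((∏ i, f (x i) t) * (8 / r ^ 2 + |∑ i, l2 (x i) t|))))
          ∂(Measure.pi fun _ : Fin n => volume.restrict 𝒳) := by
        refine lintegral_mono_ae ((hf.ae_mem n).mono fun x hx => ?_)
        refine setLIntegral_logDeriv_sq_le hr (fun t ht => hf.hasDerivAt_prod hx (hsub ht))
          (fun t ht => hf.hasDerivAt_sum hx (hsub ht)) ?_ fun t ht => (hf.prod_pos hx (hsub ht)).le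
        exact continuousOn_finsetSum _ fun i _ t ht =>
          (hf.hasDerivAt_two (x i) (hx i) t (hsub ht)).continuousAt.continuousWithinAt
    _ = ∫⁻ t in Set.Icc (c - r) (c + r), ∫⁻ x : Fin n → ℝ,
          ENNReal.ofReal (2 * ((∏ i, f (x i) t) * (8 / r ^ 2 + |∑ i, l2 (x i) t|)))
          ∂(Measure.pi fun _ : Fin n => volume.restrict 𝒳) :=
        lintegral_lintegral_swap (by
          have : Measurable fun z : (Fin n → ℝ) × ℝ =>
              2 * ((∏ i, f (z.1 i) z.2) * (8 / r ^ 2 + |∑ i, l2 (z.1 i) z.2|)) :=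
            (hm0.mul (hm2.abs.const_add _)).const_mul _
          exact this.ennreal_ofReal.aemeasurable)
    _ ≤ ∫⁻ t in Set.Icc (c - r) (c + r), 2 * (ENNReal.ofReal (8 / r ^ 2) + n * M) := by
        refine setLIntegral_mono' measurableSet_Icc fun t ht => ?_
        have := hf.isProbabilityMeasure (hsub ht)
        calc _ = 2 * ∫⁻ x, ENNReal.ofReal (8 / r ^ 2 + |∑ i, l2 (x i) t|)
              ∂(Measure.pi fun _ : Fin n => densityMeasure 𝒳 f t) := by
              rw [hf.lintegral_pi_densityMeasure (hsub ht)
                (((hs2 t).abs.const_add _).ennreal_ofReal), ← lintegral_const_mul]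
              · refine lintegral_congr_ae ((hf.ae_mem n).mono fun x hx => ?_)
                simp only
                rw [ENNReal.ofReal_mul zero_le_two,
                  ENNReal.ofReal_mul (hf.prod_pos hx (hsub ht)).le, ENNReal.ofReal_ofNat]
              · exact (hm0.comp (measurable_id.prodMk measurable_const)).ennreal_ofReal.mul
                  (((hs2 t).abs.const_add _).ennreal_ofReal)
          _ ≤ 2 * ∫⁻ x, (ENNReal.ofReal (8 / r ^ 2) + ∑ i, ENNReal.ofReal |l2 (x i) t|)
              ∂(Measure.pi fun _ : Fin n => densityMeasure 𝒳 f t) := by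
              gcongr with x
              rw [← ENNReal.ofReal_sum_of_nonneg fun i _ => abs_nonneg _,
                ← ENNReal.ofReal_add (by positivity) (by positivity)]
              exact ENNReal.ofReal_le_ofReal (by gcongr; exact Finset.abs_sum_le_sum_abs _ _)
          _ ≤ 2 * (ENNReal.ofReal (8 / r ^ 2) + n * M) := by
              have hψ : Measurable fun y => ENNReal.ofReal |l2 y t| :=
                (hf.measurable_two.comp (measurable_id.prodMk measurable_const)).abs.ennreal_ofReal
              rw [lintegral_add_left measurable_const, lintegral_const, measure_univ, mul_one,
                lintegral_pi_sum_eval _ n hψ]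
              gcongr
              exact hM t ht
    _ = _ := by
        rw [setLIntegral_const, Real.volume_Icc]; congr 2; ring

theorem measurable_pi_prod (hf : IsLogDerivFamily 𝒳 Θ f l1 l2 l3) (n : ℕ) :
    Measurable fun z : (Fin n → ℝ) × ℝ => ENNReal.ofReal (∏ i, f (z.1 i) z.2) :=
  (Finset.measurable_fun_prod _ fun i _ => hf.measurable_eval_density i).ennreal_ofReal

/-- Tonelli's theorem for expectations integrated over the parameter. -/
theorem setLIntegral_lintegral_pi_densityMeasure (hf : IsLogDerivFamily 𝒳 Θ f l1 l2 l3)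
    {W : Set ℝ} (hWm : MeasurableSet W) (hW : W ⊆ Θ) {n : ℕ} {ψ : (Fin n → ℝ) → ℝ → ENNReal}
    (hψ : Measurable (Function.uncurry ψ)) :
    ∫⁻ t in W, ∫⁻ x, ψ x t ∂(Measure.pi fun _ : Fin n => densityMeasure 𝒳 f t) =
      ∫⁻ x : Fin n → ℝ, (∫⁻ t in W, ENNReal.ofReal (∏ i, f (x i) t) * ψ x t)
        ∂(Measure.pi fun _ : Fin n => volume.restrict 𝒳) := by
  have h : Measurable fun z : ℝ × (Fin n → ℝ) =>
      ENNReal.ofReal (∏ i, f (z.2 i) z.1) * ψ z.2 z.1 :=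
    ((hf.measurable_pi_prod n).mul hψ).comp measurable_swap
  rw [← lintegral_lintegral_swap h.aemeasurable]
  refine setLIntegral_congr_fun hWm fun t ht => ?_
  exact hf.lintegral_pi_densityMeasure (hW ht) (hψ.comp (measurable_id.prodMk measurable_const))

theorem setLIntegral_lintegral_densityMeasure (hf : IsLogDerivFamily 𝒳 Θ f l1 l2 l3)
    (W : Set ℝ) {ψ : ℝ → ℝ → ENNReal} (hψ : Measurable (Function.uncurry ψ)) :
    ∫⁻ t in W, ∫⁻ x, ψ x t ∂(densityMeasure 𝒳 f t) =
      ∫⁻ x in 𝒳, (∫⁻ t in W, ENNReal.ofReal (f x t) * ψ x t) := by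
  have h : Measurable fun z : ℝ × ℝ => ENNReal.ofReal (f z.2 z.1) * ψ z.2 z.1 :=
    (hf.measurable_density.ennreal_ofReal.mul hψ).comp measurable_swap
  rw [← lintegral_lintegral_swap h.aemeasurable]
  congr with t
  exact hf.lintegral_densityMeasure t (hψ.comp (measurable_id.prodMk measurable_const))

theorem measurable_lintegral_densityMeasure (hf : IsLogDerivFamily 𝒳 Θ f l1 l2 l3)
    {ψ : ℝ → ℝ → ENNReal} (hψ : Measurable (Function.uncurry ψ)) :
    Measurable fun t => ∫⁻ x, ψ x t ∂(densityMeasure 𝒳 f t) := by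
  have h : Measurable fun z : ℝ × ℝ => ENNReal.ofReal (f z.2 z.1) * ψ z.2 z.1 :=
    (hf.measurable_density.ennreal_ofReal.mul hψ).comp measurable_swap
  have h2 := h.lintegral_prod_right' (ν := volume.restrict 𝒳)
  have h3 : (fun t => ∫⁻ x, ψ x t ∂(densityMeasure 𝒳 f t)) =
      fun t => ∫⁻ x in 𝒳, ENNReal.ofReal (f x t) * ψ x t := by
    ext t
    exact hf.lintegral_densityMeasure t (hψ.comp (measurable_id.prodMk measurable_const))
  rw [h3]
  exact h2

theorem measurable_ofReal_abs_three (hf : IsLogDerivFamily 𝒳 Θ f l1 l2 l3) :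
    Measurable (Function.uncurry fun x t => ENNReal.ofReal |l3 x t|) :=
  hf.measurable_three.abs.ennreal_ofReal

theorem measurable_ofReal_sq_one (hf : IsLogDerivFamily 𝒳 Θ f l1 l2 l3) :
    Measurable (Function.uncurry fun x t => ENNReal.ofReal (l1 x t ^ 2)) :=
  (hf.measurable_one.pow_const 2).ennreal_ofReal

/-- Local integrability of the expected squared score of one observation. -/
theorem setLIntegral_lintegral_sq_one_lt_top (hf : IsLogDerivFamily 𝒳 Θ f l1 l2 l3) {c r : ℝ}
    (hr : 0 < r) (hsub : Set.Icc (c - r) (c + r) ⊆ Θ) {M : ENNReal} (hMt : M ≠ ⊤)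
    (hM : ∀ t ∈ Set.Icc (c - r) (c + r),
      ∫⁻ x, ENNReal.ofReal |l2 x t| ∂densityMeasure 𝒳 f t ≤ M) :
    ∫⁻ t in Set.Icc (c - r / 2) (c + r / 2),
        ∫⁻ x, ENNReal.ofReal (l1 x t ^ 2) ∂densityMeasure 𝒳 f t < ⊤ := by
  have h := hf.setLIntegral_score_sq_le hr hsub hM 1
  refine lt_of_le_of_lt (le_of_eq_of_le ?_ h) ?_
  · refine setLIntegral_congr_fun measurableSet_Icc fun t ht => ?_
    have := hf.isProbabilityMeasure (hsub (Set.Icc_subset_Icc (by linarith) (by linarith) ht))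
    have h2 := (measurePreserving_eval (fun _ : Fin 1 => densityMeasure 𝒳 f t) 0).lintegral_comp
      (f := fun x => ENNReal.ofReal (l1 x t ^ 2))
      (hf.measurable_ofReal_sq_one.comp (measurable_id.prodMk measurable_const))
    rw [← h2]
    simp
  · exact ENNReal.mul_lt_top (ENNReal.mul_lt_top (by simp)
      (ENNReal.add_lt_top.2 ⟨by simp, ENNReal.mul_lt_top (by simp) hMt.lt_top⟩)) ENNReal.ofReal_lt_top

theorem measurable_setLIntegral_abs_three (hf : IsLogDerivFamily 𝒳 Θ f l1 l2 l3) (a b : ℝ) :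
    Measurable fun x => ∫⁻ s in Set.Icc a b, ENNReal.ofReal |l3 x s| :=
  (hf.measurable_ofReal_abs_three).lintegral_prod_right' (ν := volume.restrict (Set.Icc a b))

theorem ofReal_mul_min_le (hf : IsLogDerivFamily 𝒳 Θ f l1 l2 l3) {t k : ℝ} (hk : 0 < k)
    (hsub : Set.Icc (t - k) (t + k) ⊆ Θ) (K : ENNReal) {x : ℝ} (hx : x ∈ 𝒳) :
    ENNReal.ofReal (f x t) *
        min K (∫⁻ s in Set.Icc (t - k) (t + k), ENNReal.ofReal |l3 x s|) ≤
      K * ENNReal.ofReal (4 * k) *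
          (∫⁻ s in Set.Icc (t - k) (t + k),
            ENNReal.ofReal (f x s) * ENNReal.ofReal (l1 x s ^ 2)) +
        4 * ∫⁻ s in Set.Icc (t - k) (t + k), ENNReal.ofReal (f x s) * ENNReal.ofReal |l3 x s| := by
  have hm1 : Measurable fun s => ENNReal.ofReal (f x s) * ENNReal.ofReal (l1 x s ^ 2) :=
    (hf.measurable_density.ennreal_ofReal.mul hf.measurable_ofReal_sq_one).comp
      (measurable_const.prodMk measurable_id)
  have hm3 : Measurable fun s => ENNReal.ofReal (f x s) * ENNReal.ofReal |l3 x s| :=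
    (hf.measurable_density.ennreal_ofReal.mul hf.measurable_ofReal_abs_three).comp
      (measurable_const.prodMk measurable_id)
  have hm3' : Measurable fun s => ENNReal.ofReal |l3 x s| :=
    hf.measurable_ofReal_abs_three.comp (measurable_const.prodMk measurable_id)
  rcases comparable_or_ofReal_le_setLIntegral_logDeriv_sq (F := f x) (S := l1 x)
    (a := t - k) (b := t + k) (c := t) (by linarith)
    (fun s hs => hf.hasDerivAt_density x hx s (hsub hs))
    (fun s hs => (hf.hasDerivAt_one x hx s (hsub hs)).continuousAt.continuousWithinAt)
    (fun s hs => (hf.pos x hx s (hsub hs)).le) ⟨by linarith, by linarith⟩ with h | h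
  · refine le_add_left ?_
    calc _ ≤ ENNReal.ofReal (f x t) *
            ∫⁻ s in Set.Icc (t - k) (t + k), ENNReal.ofReal |l3 x s| := by
          gcongr; exact min_le_right _ _
      _ ≤ _ := by
          rw [← lintegral_const_mul _ hm3', ← lintegral_const_mul _ hm3]
          refine setLIntegral_mono' measurableSet_Icc fun s hs => ?_
          rw [← mul_assoc]
          gcongr
          rw [← ENNReal.ofReal_ofNat 4, ← ENNReal.ofReal_mul (by norm_num)]
          exact ENNReal.ofReal_le_ofReal (h s hs)
  · refine le_add_right ?_
    calc _ ≤ (∫⁻ s in Set.Icc (t - k) (t + k),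
            ENNReal.ofReal (2 * (t + k - (t - k)) * (f x s * l1 x s ^ 2))) * K := by
          gcongr; exact min_le_left _ _
      _ = _ := by
          rw [mul_comm, mul_assoc]
          congr 1
          rw [← lintegral_const_mul _ hm1]
          refine setLIntegral_congr_fun measurableSet_Icc fun s hs => ?_
          rw [← ENNReal.ofReal_mul (hf.pos x hx s (hsub hs)).le,
            ← ENNReal.ofReal_mul (by positivity)]
          congr 1
          ring

/-- Markov-type bound for the local variation of the second derivative of the log-likelihood,
truncated at the level `K`. -/
theorem mul_measure_variation_le (hf : IsLogDerivFamily 𝒳 Θ f l1 l2 l3) {t k : ℝ} (hk : 0 < k)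
    (hsub : Set.Icc (t - k) (t + k) ⊆ Θ) {K : ENNReal} (n : ℕ) :
    K * (Measure.pi fun _ : Fin n => densityMeasure 𝒳 f t)
        {x | K ≤ ∑ i, ∫⁻ s in Set.Icc (t - k) (t + k), ENNReal.ofReal |l3 (x i) s|} ≤
      n * (K * ENNReal.ofReal (4 * k) * (∫⁻ s in Set.Icc (t - k) (t + k),
            ∫⁻ x, ENNReal.ofReal (l1 x s ^ 2) ∂densityMeasure 𝒳 f s) +
        4 * ∫⁻ s in Set.Icc (t - k) (t + k),
            ∫⁻ x, ENNReal.ofReal |l3 x s| ∂densityMeasure 𝒳 f s) := by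
  have ht : t ∈ Θ := hsub ⟨by linarith, by linarith⟩
  have := hf.isProbabilityMeasure ht
  set Y : ℝ → ENNReal := fun x => ∫⁻ s in Set.Icc (t - k) (t + k), ENNReal.ofReal |l3 x s| with hY
  have hYm : Measurable Y := hf.measurable_setLIntegral_abs_three _ _
  have hψ : Measurable fun x => min K (Y x) := measurable_const.min hYm
  have hm : ∀ {ψ : ℝ → ℝ → ENNReal}, Measurable (Function.uncurry ψ) →
      Measurable fun x => ∫⁻ s in Set.Icc (t - k) (t + k), ENNReal.ofReal (f x s) * ψ x s :=
    fun h => (hf.measurable_density.ennreal_ofReal.mul h).lintegral_prod_right'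
      (ν := volume.restrict (Set.Icc (t - k) (t + k)))
  calc _ ≤ K * (Measure.pi fun _ : Fin n => densityMeasure 𝒳 f t)
        {x | K ≤ ∑ i, min K (Y (x i))} := by
        suffices h : {x : Fin n → ℝ | K ≤ ∑ i, Y (x i)} ⊆ {x | K ≤ ∑ i, min K (Y (x i))} from
          mul_le_mul_right (measure_mono h) K
        intro x hx
        simp only [Set.mem_ofPred_eq] at hx ⊢
        by_cases h : ∃ i, K ≤ Y (x i)
        · obtain ⟨i, hi⟩ := h
          calc K = min K (Y (x i)) := (min_eq_left hi).symm
            _ ≤ _ := Finset.single_le_sum (f := fun i => min K (Y (x i))) (fun _ _ => zero_le)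
              (Finset.mem_univ i)
        · push Not at h
          rwa [Finset.sum_congr rfl fun i _ => min_eq_right (h i).le]
    _ ≤ ∫⁻ x, ∑ i, min K (Y (x i)) ∂(Measure.pi fun _ : Fin n => densityMeasure 𝒳 f t) :=
        mul_meas_ge_le_lintegral (Finset.measurable_fun_sum _ fun i _ =>
          hψ.comp (measurable_pi_apply i)) K
    _ = n * ∫⁻ x, min K (Y x) ∂densityMeasure 𝒳 f t := lintegral_pi_sum_eval _ n hψ
    _ ≤ _ := by
        gcongr
        rw [hf.lintegral_densityMeasure t hψ,
          hf.setLIntegral_lintegral_densityMeasure _ hf.measurable_ofReal_abs_three,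
          hf.setLIntegral_lintegral_densityMeasure _ hf.measurable_ofReal_sq_one,
          ← lintegral_const_mul _ (hm hf.measurable_ofReal_abs_three),
          ← lintegral_const_mul _ (hm hf.measurable_ofReal_sq_one),
          ← lintegral_add_left ((hm hf.measurable_ofReal_sq_one).const_mul _)]
        exact setLIntegral_mono' hf.measurableSet fun x hx => hf.ofReal_mul_min_le hk hsub K hx

theorem measurable_sum_variation (hf : IsLogDerivFamily 𝒳 Θ f l1 l2 l3) (n : ℕ) (k : ℝ) :
    Measurable fun z : (Fin n → ℝ) × ℝ =>
      ∑ i, ∫⁻ s in Set.Icc (z.2 - k) (z.2 + k), ENNReal.ofReal |l3 (z.1 i) s| := by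
  refine Finset.measurable_fun_sum _ fun i _ => ?_
  have hS : MeasurableSet {w : ((Fin n → ℝ) × ℝ) × ℝ | w.2 ∈ Set.Icc (w.1.2 - k) (w.1.2 + k)} := by
    refine (measurableSet_le (f := fun w : ((Fin n → ℝ) × ℝ) × ℝ => w.1.2 - k)
      (g := fun w => w.2) (by fun_prop) (by fun_prop)).inter
      (measurableSet_le (f := fun w : ((Fin n → ℝ) × ℝ) × ℝ => w.2)
      (g := fun w => w.1.2 + k) (by fun_prop) (by fun_prop))
  have hproj : Measurable fun w : ((Fin n → ℝ) × ℝ) × ℝ => (w.1.1 i, w.2) := by fun_prop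
  have h1 : Measurable fun w : ((Fin n → ℝ) × ℝ) × ℝ => ENNReal.ofReal |l3 (w.1.1 i) w.2| :=
    hf.measurable_ofReal_abs_three.comp hproj
  have h := (h1.indicator hS).lintegral_prod_right' (ν := (volume : Measure ℝ))
  convert h using 2 with z
  rw [← lintegral_indicator measurableSet_Icc]
  rfl

set_option maxHeartbeats 1000000 in
/-- If a likelihood is maximised near `c` and the second derivative of the log-likelihood varies
by `K` around the maximiser, then the likelihood at `c` is controlled by an average of likelihoods
at nearby parameters at which the second derivative also varies by `K`. -/
theorem measure_variation_at_argmax_le (hf : IsLogDerivFamily 𝒳 Θ f l1 l2 l3) {c r h : ℝ}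
    (hh : 0 < h) (hhr : h ≤ r / 4) (hsub : Set.Icc (c - r) (c + r) ⊆ Θ) {n : ℕ}
    {τ : (Fin n → ℝ) → ℝ}
    (hτ : ∀ x : Fin n → ℝ, (∀ i, x i ∈ 𝒳) → ∏ i, f (x i) c ≤ ∏ i, f (x i) (τ x)) (K : ENNReal) :
    (Measure.pi fun _ : Fin n => densityMeasure 𝒳 f c)
        {x | |τ x - c| ≤ r / 4 ∧
          K ≤ ∑ i, ∫⁻ s in Set.Icc (τ x - h) (τ x + h), ENNReal.ofReal |l3 (x i) s|} ≤
      ∫⁻ t in Set.Icc (c - r / 2) (c + r / 2),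
        (ENNReal.ofReal (1 / h) * (Measure.pi fun _ : Fin n => densityMeasure 𝒳 f t)
            {x | K ≤ ∑ i, ∫⁻ s in Set.Icc (t - 2 * h) (t + 2 * h), ENNReal.ofReal |l3 (x i) s|} +
          ENNReal.ofReal (2 * h) * ∫⁻ x, ENNReal.ofReal ((∑ i, l1 (x i) t) ^ 2)
            ∂(Measure.pi fun _ : Fin n => densityMeasure 𝒳 f t)) := by
  have hJ : Set.Icc (c - r / 2) (c + r / 2) ⊆ Θ :=
    (Set.Icc_subset_Icc (by linarith) (by linarith)).trans hsub
  have hc : c ∈ Θ := hsub ⟨by linarith, by linarith⟩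
  set A : Set ((Fin n → ℝ) × ℝ) := {z | K ≤ ∑ i,
    ∫⁻ s in Set.Icc (z.2 - 2 * h) (z.2 + 2 * h), ENNReal.ofReal |l3 (z.1 i) s|} with hA
  have hAm : MeasurableSet A :=
    measurableSet_le measurable_const (hf.measurable_sum_variation n (2 * h))
  have hs1 : Measurable fun z : (Fin n → ℝ) × ℝ => ENNReal.ofReal ((∑ i, l1 (z.1 i) z.2) ^ 2) :=
    ((Finset.measurable_fun_sum _ fun i _ => hf.measurable_eval_one i).pow_const 2).ennreal_ofReal
  set ψ : (Fin n → ℝ) → ℝ → ENNReal := fun x t =>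
    ENNReal.ofReal (1 / h) * A.indicator 1 (x, t) +
      ENNReal.ofReal (2 * h) * ENNReal.ofReal ((∑ i, l1 (x i) t) ^ 2) with hψ
  have hAi : Measurable fun z => A.indicator (1 : (Fin n → ℝ) × ℝ → ENNReal) z :=
    _root_.measurable_one.indicator hAm
  have hψm : Measurable (Function.uncurry ψ) := (hAi.const_mul _).add (hs1.const_mul _)
  set H : (Fin n → ℝ) → ENNReal := fun x =>
    ∫⁻ t in Set.Icc (c - r / 2) (c + r / 2), ENNReal.ofReal (∏ i, f (x i) t) * ψ x t with hH
  have hHm : Measurable H := ((hf.measurable_pi_prod n).mul hψm).lintegral_prod_right'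
    (ν := volume.restrict (Set.Icc (c - r / 2) (c + r / 2)))
  have hF0 : Measurable fun x : Fin n → ℝ => ENNReal.ofReal (∏ i, f (x i) c) :=
    (hf.measurable_pi_prod n).comp (measurable_id.prodMk measurable_const)
  have hB : MeasurableSet {x : Fin n → ℝ | ENNReal.ofReal (∏ i, f (x i) c) ≤ H x} :=
    measurableSet_le hF0 hHm
  have hac : (Measure.pi fun _ : Fin n => densityMeasure 𝒳 f c) ≪
      Measure.pi fun _ : Fin n => volume.restrict 𝒳 := by
    rw [hf.pi_densityMeasure hc]
    exact withDensity_absolutelyContinuous _ _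
  calc _ ≤ (Measure.pi fun _ : Fin n => densityMeasure 𝒳 f c)
          {x | ENNReal.ofReal (∏ i, f (x i) c) ≤ H x} := by
        have hae : ∀ᵐ x ∂(Measure.pi fun _ : Fin n => densityMeasure 𝒳 f c), ∀ i, x i ∈ 𝒳 :=
          hac.ae_le (hf.ae_mem n)
        refine measure_mono_ae ?_
        filter_upwards [hae] with x hx
        rintro ⟨h1, h2⟩
        have hl := abs_le.1 h1
        have hsub1 : Set.Icc (τ x - h) (τ x + h) ⊆ Set.Icc (c - r / 2) (c + r / 2) :=
          Set.Icc_subset_Icc (by linarith) (by linarith)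
        have h3 := ofReal_le_setLIntegral_logDeriv_sq (F := fun t => ∏ i, f (x i) t)
          (S := fun t => ∑ i, l1 (x i) t) (a := τ x - h) (b := τ x + h) (c := τ x) (by linarith)
          (fun t ht => hf.hasDerivAt_prod hx (hJ (hsub1 ht)))
          (fun t ht => (hf.hasDerivAt_sum hx (hJ (hsub1 ht))).continuousAt.continuousWithinAt)
          (fun t ht => (hf.prod_pos hx (hJ (hsub1 ht))).le) ⟨by linarith, by linarith⟩
        have h4 : ENNReal.ofReal (∏ i, f (x i) c) ≤ H x := by
          refine (ENNReal.ofReal_le_ofReal (hτ x hx)).trans (h3.trans ?_)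
          refine le_trans ?_ (lintegral_mono_set hsub1)
          refine setLIntegral_mono' measurableSet_Icc fun t ht => ?_
          have hmem : (x, t) ∈ A := by
            refine h2.trans (Finset.sum_le_sum fun i _ => lintegral_mono_set ?_)
            exact Set.Icc_subset_Icc (by linarith [ht.1, ht.2]) (by linarith [ht.1, ht.2])
          have hFt := (hf.prod_pos hx (hJ (hsub1 ht))).le
          simp only [hψ, Set.indicator_of_mem hmem, Pi.one_apply, mul_one]
          rw [← ENNReal.ofReal_mul (by positivity),
            ← ENNReal.ofReal_add (by positivity) (by positivity), ← ENNReal.ofReal_mul hFt]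
          refine ENNReal.ofReal_le_ofReal (le_of_eq ?_)
          congr 1
          rw [show τ x + h - (τ x - h) = 2 * h by ring, show 2 / (2 * h) = 1 / h by field_simp]
        exact h4
    _ = ∫⁻ x, {x : Fin n → ℝ | ENNReal.ofReal (∏ i, f (x i) c) ≤ H x}.indicator 1 x
          ∂(Measure.pi fun _ : Fin n => densityMeasure 𝒳 f c) := (lintegral_indicator_one hB).symm
    _ ≤ ∫⁻ x, H x ∂(Measure.pi fun _ : Fin n => volume.restrict 𝒳) := by
        rw [hf.lintegral_pi_densityMeasure hc (_root_.measurable_one.indicator hB)]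
        refine lintegral_mono fun x => ?_
        by_cases hx : x ∈ {x : Fin n → ℝ | ENNReal.ofReal (∏ i, f (x i) c) ≤ H x}
        · simpa [Set.indicator_of_mem hx] using hx
        · simp [Set.indicator_of_notMem hx]
    _ = ∫⁻ t in Set.Icc (c - r / 2) (c + r / 2),
          ∫⁻ x, ψ x t ∂(Measure.pi fun _ : Fin n => densityMeasure 𝒳 f t) :=
        (hf.setLIntegral_lintegral_pi_densityMeasure measurableSet_Icc hJ hψm).symm
    _ = _ := by
        congr with t
        have hAt : Measurable fun x : Fin n → ℝ =>
            A.indicator (1 : (Fin n → ℝ) × ℝ → ENNReal) (x, t) :=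
          hAi.comp (measurable_id.prodMk measurable_const)
        have hst : Measurable fun x : Fin n → ℝ => ENNReal.ofReal ((∑ i, l1 (x i) t) ^ 2) :=
          hs1.comp (measurable_id.prodMk measurable_const)
        simp only [hψ]
        rw [lintegral_add_left (hAt.const_mul _), lintegral_const_mul _ hAt,
          lintegral_const_mul _ hst]
        congr 2
        have hAtm : MeasurableSet {x : Fin n → ℝ | (x, t) ∈ A} :=
          (measurable_id.prodMk measurable_const) hAm
        exact lintegral_indicator_one hAtm

end IsLogDerivFamily

theorem setLIntegral_setLIntegral_Icc_le {φ : ℝ → ENNReal} (hφ : Measurable φ) {k : ℝ}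
    {J J' : Set ℝ} (hJ'm : MeasurableSet J')
    (hJ : ∀ t ∈ J', Set.Icc (t - k) (t + k) ⊆ J) :
    ∫⁻ t in J', ∫⁻ s in Set.Icc (t - k) (t + k), φ s ≤
      ENNReal.ofReal (2 * k) * ∫⁻ s in J, φ s := by
  have hS : MeasurableSet {w : ℝ × ℝ | w.2 ∈ Set.Icc (w.1 - k) (w.1 + k)} :=
    (measurableSet_le (f := fun w : ℝ × ℝ => w.1 - k)
      (g := fun w => w.2) (by fun_prop) (by fun_prop)).inter
      (measurableSet_le (f := fun w : ℝ × ℝ => w.2)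
      (g := fun w => w.1 + k) (by fun_prop) (by fun_prop))
  have hm : Measurable fun w : ℝ × ℝ => (Set.Icc (w.1 - k) (w.1 + k)).indicator φ w.2 :=
    (hφ.comp measurable_snd).indicator hS
  calc _ = ∫⁻ t in J', ∫⁻ s in J, (Set.Icc (t - k) (t + k)).indicator φ s := by
        refine setLIntegral_congr_fun hJ'm fun t ht => ?_
        rw [lintegral_indicator measurableSet_Icc, Measure.restrict_restrict measurableSet_Icc,
          Set.inter_eq_left.2 (hJ t ht)]
    _ = ∫⁻ s in J, ∫⁻ t in J', (Set.Icc (t - k) (t + k)).indicator φ s :=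
        lintegral_lintegral_swap hm.aemeasurable
    _ ≤ ∫⁻ s in J, ENNReal.ofReal (2 * k) * φ s := by
        refine lintegral_mono fun s => ?_
        calc _ ≤ ∫⁻ t, (Set.Icc (t - k) (t + k)).indicator φ s :=
              setLIntegral_le_lintegral _ _
          _ = ∫⁻ t, (Set.Icc (s - k) (s + k)).indicator (fun _ => φ s) t := by
              congr with t
              by_cases h : s ∈ Set.Icc (t - k) (t + k)
              · rw [Set.indicator_of_mem h, Set.indicator_of_mem]
                exact ⟨by linarith [h.2], by linarith [h.1]⟩
              · rw [Set.indicator_of_notMem h, Set.indicator_of_notMem]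
                exact fun h' => h ⟨by linarith [h'.2], by linarith [h'.1]⟩
          _ = _ := by
              rw [lintegral_indicator measurableSet_Icc, setLIntegral_const, Real.volume_Icc,
                mul_comm]
              congr 2
              ring
    _ = _ := lintegral_const_mul _ hφ

namespace IsLogDerivFamily

variable {𝒳 Θ : Set ℝ} {f l1 l2 l3 : ℝ → ℝ → ℝ}

theorem measure_variation_le (hf : IsLogDerivFamily 𝒳 Θ f l1 l2 l3) {t h ε : ℝ} (hh : 0 < h)
    (hε : 0 < ε) (hsub : Set.Icc (t - 2 * h) (t + 2 * h) ⊆ Θ) {M : ENNReal}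
    (hM : ∀ s ∈ Set.Icc (t - 2 * h) (t + 2 * h),
      ∫⁻ x, ENNReal.ofReal |l3 x s| ∂densityMeasure 𝒳 f s ≤ M) {n : ℕ} (hn : 0 < n) :
    (Measure.pi fun _ : Fin n => densityMeasure 𝒳 f t)
        {x | ENNReal.ofReal (ε * n) ≤
          ∑ i, ∫⁻ s in Set.Icc (t - 2 * h) (t + 2 * h), ENNReal.ofReal |l3 (x i) s|} ≤
      ENNReal.ofReal (8 * h * n) * (∫⁻ s in Set.Icc (t - 2 * h) (t + 2 * h),
            ∫⁻ x, ENNReal.ofReal (l1 x s ^ 2) ∂densityMeasure 𝒳 f s) +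
        ENNReal.ofReal (16 * h / ε) * M := by
  have hn' : (0 : ℝ) < n := Nat.cast_pos.2 hn
  have hK : 0 < ε * n := by positivity
  have h1 := hf.mul_measure_variation_le (k := 2 * h) (by positivity) hsub
    (K := ENNReal.ofReal (ε * n)) n
  have h3 : ∫⁻ s in Set.Icc (t - 2 * h) (t + 2 * h),
      ∫⁻ x, ENNReal.ofReal |l3 x s| ∂densityMeasure 𝒳 f s ≤ M * ENNReal.ofReal (4 * h) := by
    refine (setLIntegral_mono' measurableSet_Icc hM).trans_eq ?_
    rw [setLIntegral_const, Real.volume_Icc]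
    congr 2
    ring
  rw [← ENNReal.mul_le_mul_iff_right (a := ENNReal.ofReal (ε * n)) (by simpa using hK)
    ENNReal.ofReal_ne_top]
  refine h1.trans ?_
  rw [mul_add, mul_add]
  refine add_le_add (le_of_eq ?_) ?_
  · have h2 : ENNReal.ofReal (8 * h * n) = n * ENNReal.ofReal (4 * (2 * h)) := by
      rw [← ENNReal.ofReal_natCast, ← ENNReal.ofReal_mul hn'.le]
      congr 1
      ring
    rw [h2]
    ring
  · calc _ ≤ (n : ENNReal) * (4 * (M * ENNReal.ofReal (4 * h))) := by gcongr
      _ = _ := by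
        rw [← mul_assoc (ENNReal.ofReal _), ← ENNReal.ofReal_mul hK.le, mul_comm M, ← mul_assoc,
          ← mul_assoc, ← ENNReal.ofReal_natCast, ← ENNReal.ofReal_ofNat 4,
          ← ENNReal.ofReal_mul hn'.le, ← ENNReal.ofReal_mul (by positivity)]
        congr 2
        field_simp
        norm_num

theorem measure_variation_at_argmax_le_of_le (hf : IsLogDerivFamily 𝒳 Θ f l1 l2 l3)
    {c r C ε : ℝ} (hr : 0 < r) (hC : 0 < C) (hε : 0 < ε) (hsub : Set.Icc (c - r) (c + r) ⊆ Θ)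
    {M : ENNReal}
    (hM2 : ∀ s ∈ Set.Icc (c - r) (c + r),
      ∫⁻ x, ENNReal.ofReal |l2 x s| ∂densityMeasure 𝒳 f s ≤ M)
    (hM3 : ∀ s ∈ Set.Icc (c - r) (c + r),
      ∫⁻ x, ENNReal.ofReal |l3 x s| ∂densityMeasure 𝒳 f s ≤ M)
    {n : ℕ} (hn : 0 < n) (hCn : C / n ≤ r / 4) {τ : (Fin n → ℝ) → ℝ}
    (hτ : ∀ x : Fin n → ℝ, (∀ i, x i ∈ 𝒳) → ∏ i, f (x i) c ≤ ∏ i, f (x i) (τ x)) :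
    (Measure.pi fun _ : Fin n => densityMeasure 𝒳 f c)
        {x | |τ x - c| ≤ r / 4 ∧ ENNReal.ofReal (ε * n) ≤
          ∑ i, ∫⁻ s in Set.Icc (τ x - C / n) (τ x + C / n), ENNReal.ofReal |l3 (x i) s|} ≤
      ENNReal.ofReal (32 * C) * (∫⁻ s in Set.Icc (c - r) (c + r),
            ∫⁻ x, ENNReal.ofReal (l1 x s ^ 2) ∂densityMeasure 𝒳 f s) +
        ENNReal.ofReal (16 / ε * r) * M + (ENNReal.ofReal (64 * C / r / n) +
        ENNReal.ofReal (8 * C * r) * M) := by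
  have hn' : (0 : ℝ) < n := Nat.cast_pos.2 hn
  set h := C / n with hh_def
  have hh : 0 < h := by positivity
  have hhn : h * n = C := by rw [hh_def]; field_simp
  refine (hf.measure_variation_at_argmax_le hh hCn hsub hτ _).trans ?_
  set e1 : ℝ → ENNReal := fun s => ∫⁻ x, ENNReal.ofReal (l1 x s ^ 2) ∂densityMeasure 𝒳 f s with he1
  have he1m : Measurable e1 := hf.measurable_lintegral_densityMeasure hf.measurable_ofReal_sq_one
  have hW : ∀ t ∈ Set.Icc (c - r / 2) (c + r / 2),
      Set.Icc (t - 2 * h) (t + 2 * h) ⊆ Set.Icc (c - r) (c + r) := fun t ht =>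
    Set.Icc_subset_Icc (by linarith [ht.1]) (by linarith [ht.2])
  have hWm : Measurable fun t => ∫⁻ s in Set.Icc (t - 2 * h) (t + 2 * h), e1 s := by
    have hS : MeasurableSet {w : ℝ × ℝ | w.2 ∈ Set.Icc (w.1 - 2 * h) (w.1 + 2 * h)} :=
      (measurableSet_le (f := fun w : ℝ × ℝ => w.1 - 2 * h)
        (g := fun w => w.2) (by fun_prop) (by fun_prop)).inter
        (measurableSet_le (f := fun w : ℝ × ℝ => w.2)
        (g := fun w => w.1 + 2 * h) (by fun_prop) (by fun_prop))
    have hm := ((he1m.comp measurable_snd).indicator hS).lintegral_prod_right'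
      (ν := (volume : Measure ℝ))
    convert hm using 2 with t
    rw [← lintegral_indicator measurableSet_Icc]
    rfl
  calc _ ≤ ∫⁻ t in Set.Icc (c - r / 2) (c + r / 2),
        ((ENNReal.ofReal (8 * C / h) * (∫⁻ s in Set.Icc (t - 2 * h) (t + 2 * h), e1 s) +
          ENNReal.ofReal (16 / ε) * M) + ENNReal.ofReal (2 * h) *
          ∫⁻ x, ENNReal.ofReal ((∑ i, l1 (x i) t) ^ 2)
            ∂(Measure.pi fun _ : Fin n => densityMeasure 𝒳 f t)) := by
        refine setLIntegral_mono' measurableSet_Icc fun t ht => add_le_add_left ?_ _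
        refine (mul_le_mul_right (hf.measure_variation_le hh hε ((hW t ht).trans hsub)
          (fun s hs => hM3 s (hW t ht hs)) hn) _).trans_eq ?_
        rw [mul_add, ← mul_assoc, ← mul_assoc, ← ENNReal.ofReal_mul (by positivity),
          ← ENNReal.ofReal_mul (by positivity)]
        congr 3
        · rw [← hhn]; field_simp
        · field_simp
    _ = ENNReal.ofReal (8 * C / h) * (∫⁻ t in Set.Icc (c - r / 2) (c + r / 2),
          ∫⁻ s in Set.Icc (t - 2 * h) (t + 2 * h), e1 s) +
          ENNReal.ofReal (16 / ε) * M * ENNReal.ofReal r + ENNReal.ofReal (2 * h) *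
          ∫⁻ t in Set.Icc (c - r / 2) (c + r / 2), ∫⁻ x, ENNReal.ofReal ((∑ i, l1 (x i) t) ^ 2)
            ∂(Measure.pi fun _ : Fin n => densityMeasure 𝒳 f t) := by
        rw [lintegral_add_left ((hWm.const_mul _).add_const _), lintegral_add_right _
          measurable_const, lintegral_const_mul _ hWm, setLIntegral_const, Real.volume_Icc,
          lintegral_const_mul' _ _ ENNReal.ofReal_ne_top]
        congr 4
        ring
    _ ≤ ENNReal.ofReal (8 * C / h) * (ENNReal.ofReal (2 * (2 * h)) *
            ∫⁻ s in Set.Icc (c - r) (c + r), e1 s) +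
          ENNReal.ofReal (16 / ε) * M * ENNReal.ofReal r + ENNReal.ofReal (2 * h) *
          (2 * (ENNReal.ofReal (8 / r ^ 2) + n * M) * ENNReal.ofReal (2 * r)) := by
        gcongr
        · exact setLIntegral_setLIntegral_Icc_le he1m measurableSet_Icc hW
        · exact hf.setLIntegral_score_sq_le hr hsub hM2 n
    _ = _ := by
        congr 1
        · congr 1
          · rw [← mul_assoc, ← ENNReal.ofReal_mul (by positivity)]
            congr 2
            field_simp
            norm_num
          · rw [mul_right_comm, ← ENNReal.ofReal_mul (by positivity)]
        · have two : (2 : ENNReal) = ENNReal.ofReal 2 := (ENNReal.ofReal_ofNat 2).symm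
          have h1 : ENNReal.ofReal (64 * C / r / n) =
              ENNReal.ofReal (2 * h) * (2 * ENNReal.ofReal (8 / r ^ 2) * ENNReal.ofReal (2 * r)) := by
            rw [two, ← ENNReal.ofReal_mul (by positivity),
              ← ENNReal.ofReal_mul (by positivity), ← ENNReal.ofReal_mul (by positivity)]
            congr 1
            rw [hh_def]
            field_simp
            norm_num
          have h2 : ENNReal.ofReal (8 * C * r) =
              ENNReal.ofReal (2 * h) * (2 * n * ENNReal.ofReal (2 * r)) := by
            rw [two, ← ENNReal.ofReal_natCast,
              ← ENNReal.ofReal_mul (by positivity), ← ENNReal.ofReal_mul (by positivity),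
              ← ENNReal.ofReal_mul (by positivity)]
            congr 1
            rw [← hhn]
            ring
          rw [h1, h2]
          ring

theorem tendsto_setLIntegral_sq_one (hf : IsLogDerivFamily 𝒳 Θ f l1 l2 l3) {c r : ℝ}
    (hr : 0 < r) (hsub : Set.Icc (c - r) (c + r) ⊆ Θ) {M : ENNReal} (hMt : M ≠ ⊤)
    (hM : ∀ t ∈ Set.Icc (c - r) (c + r),
      ∫⁻ x, ENNReal.ofReal |l2 x t| ∂densityMeasure 𝒳 f t ≤ M) :
    Tendsto (fun ρ => ∫⁻ t in Set.Icc (c - ρ) (c + ρ),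
        ∫⁻ x, ENNReal.ofReal (l1 x t ^ 2) ∂densityMeasure 𝒳 f t) (nhdsWithin 0 (Set.Ioi 0))
      (nhds 0) := by
  have h := tendsto_setLIntegral_zero
    (μ := volume.restrict (Set.Icc (c - r / 2) (c + r / 2)))
    (l := nhdsWithin (0 : ℝ) (Set.Ioi 0)) (s := fun ρ : ℝ => Set.Icc (c - ρ) (c + ρ))
    (hf.setLIntegral_lintegral_sq_one_lt_top hr hsub hMt hM).ne ?_
  · refine h.congr' ?_
    filter_upwards [Ioo_mem_nhdsGT (half_pos hr)] with ρ hρ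
    rw [Measure.restrict_restrict measurableSet_Icc, Set.inter_eq_left.2]
    exact Set.Icc_subset_Icc (by linarith [hρ.2]) (by linarith [hρ.2])
  · have h0 : Tendsto (fun ρ : ℝ => ENNReal.ofReal (2 * ρ)) (nhdsWithin 0 (Set.Ioi 0)) (nhds 0) := by
      have : Tendsto (fun ρ : ℝ => ENNReal.ofReal (2 * ρ)) (nhds 0) (nhds (ENNReal.ofReal (2 * 0))) :=
        (ENNReal.continuous_ofReal.comp (continuous_const.mul continuous_id)).tendsto 0
      simp only [mul_zero, ENNReal.ofReal_zero] at this
      exact this.mono_left nhdsWithin_le_nhds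
    refine tendsto_of_tendsto_of_tendsto_of_le_of_le tendsto_const_nhds h0 (fun _ => zero_le)
      fun ρ => (Measure.restrict_apply_le _ _).trans_eq ?_
    rw [Real.volume_Icc]
    congr 1
    ring

/-- In a neighbourhood of the maximum likelihood estimator of size `O(1 / n)`, the second
derivative of the log-likelihood of a sample of size `n` varies by `o(n)` in probability. -/
theorem tendsto_measure_variation_at_argmax (hf : IsLogDerivFamily 𝒳 Θ f l1 l2 l3) {c r : ℝ}
    (hr : 0 < r) (hsub : Set.Icc (c - r) (c + r) ⊆ Θ) {M : ENNReal} (hMt : M ≠ ⊤)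
    (hM2 : ∀ s ∈ Set.Icc (c - r) (c + r),
      ∫⁻ x, ENNReal.ofReal |l2 x s| ∂densityMeasure 𝒳 f s ≤ M)
    (hM3 : ∀ s ∈ Set.Icc (c - r) (c + r),
      ∫⁻ x, ENNReal.ofReal |l3 x s| ∂densityMeasure 𝒳 f s ≤ M)
    {τ : (n : ℕ) → (Fin n → ℝ) → ℝ}
    (hτ : ∀ (n : ℕ) (x : Fin n → ℝ), (∀ i, x i ∈ 𝒳) →
      ∏ i, f (x i) c ≤ ∏ i, f (x i) (τ n x))
    (hcons : ∀ δ : ℝ, 0 < δ → Tendsto (fun n =>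
      (Measure.pi fun _ : Fin n => densityMeasure 𝒳 f c) {x | δ < |τ n x - c|}) atTop (nhds 0))
    {C ε : ℝ} (hC : 0 < C) (hε : 0 < ε) :
    Tendsto (fun n => (Measure.pi fun _ : Fin n => densityMeasure 𝒳 f c)
        {x | ENNReal.ofReal (ε * n) ≤ ∑ i,
          ∫⁻ s in Set.Icc (τ n x - C / n) (τ n x + C / n), ENNReal.ofReal |l3 (x i) s|})
      atTop (nhds 0) := by
  rw [ENNReal.tendsto_nhds_zero]
  intro δ hδ
  have hδ3 : 0 < δ / 3 := ENNReal.div_pos hδ.ne' (by simp)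
  have hlin : ∀ a : ℝ, Tendsto (fun ρ : ℝ => ENNReal.ofReal (a * ρ) * M)
      (nhdsWithin 0 (Set.Ioi 0)) (nhds 0) := fun a => by
    have : Tendsto (fun ρ : ℝ => ENNReal.ofReal (a * ρ) * M) (nhds 0)
        (nhds (ENNReal.ofReal (a * 0) * M)) :=
      ENNReal.Tendsto.mul_const ((ENNReal.continuous_ofReal.comp
        (continuous_const.mul continuous_id)).tendsto 0) (Or.inr hMt)
    simp only [mul_zero, ENNReal.ofReal_zero, zero_mul] at this
    exact this.mono_left nhdsWithin_le_nhds
  have hI : Tendsto (fun ρ => ENNReal.ofReal (32 * C) * ∫⁻ t in Set.Icc (c - ρ) (c + ρ),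
        ∫⁻ x, ENNReal.ofReal (l1 x t ^ 2) ∂densityMeasure 𝒳 f t) (nhdsWithin 0 (Set.Ioi 0))
      (nhds 0) := by
    simpa using ENNReal.Tendsto.const_mul (a := ENNReal.ofReal (32 * C))
      (hf.tendsto_setLIntegral_sq_one hr hsub hMt hM2) (Or.inr ENNReal.ofReal_ne_top)
  have hall := (hI.add (hlin (16 / ε))).add (hlin (8 * C))
  simp only [add_zero] at hall
  obtain ⟨ρ, hρ, hρr⟩ :=
    ((ENNReal.tendsto_nhds_zero.1 hall (δ / 3) hδ3).and (Ioo_mem_nhdsGT hr)).exists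
  have hsub' : Set.Icc (c - ρ) (c + ρ) ⊆ Set.Icc (c - r) (c + r) :=
    Set.Icc_subset_Icc (by linarith [hρr.2]) (by linarith [hρr.2])
  have hn1 : Tendsto (fun n : ℕ => ENNReal.ofReal (64 * C / ρ / n)) atTop (nhds 0) := by
    simpa [Function.comp_def] using (ENNReal.continuous_ofReal.tendsto 0).comp
      (tendsto_const_div_atTop_nhds_zero_nat (64 * C / ρ))
  have hn2 : ∀ᶠ n : ℕ in atTop, C / n ≤ ρ / 4 :=
    (tendsto_const_div_atTop_nhds_zero_nat C).eventually_le_const (by linarith [hρr.1])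
  filter_upwards [ENNReal.tendsto_nhds_zero.1 hn1 _ hδ3, hn2, eventually_gt_atTop 0,
    ENNReal.tendsto_nhds_zero.1 (hcons (ρ / 4) (by linarith [hρr.1])) _ hδ3] with n h1 h2 h3 h4
  have h5 := hf.measure_variation_at_argmax_le_of_le hρr.1 hC hε (hsub'.trans hsub)
    (fun s hs => hM2 s (hsub' hs)) (fun s hs => hM3 s (hsub' hs)) h3 h2 (hτ n)
  refine (measure_mono (t := {x | ρ / 4 < |τ n x - c|} ∪ {x | |τ n x - c| ≤ ρ / 4 ∧
    ENNReal.ofReal (ε * n) ≤ ∑ i, ∫⁻ s in Set.Icc (τ n x - C / n) (τ n x + C / n),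
      ENNReal.ofReal |l3 (x i) s|}) ?_).trans ((measure_union_le _ _).trans ?_)
  · intro x hx
    rcases lt_or_ge (ρ / 4) |τ n x - c| with h | h
    · exact Or.inl h
    · exact Or.inr ⟨h, hx⟩
  · calc _ ≤ δ / 3 + (δ / 3 + δ / 3) := by
          refine add_le_add h4 (h5.trans ?_)
          rw [add_comm (ENNReal.ofReal _), ← add_assoc]
          exact add_le_add hρ h1
      _ = δ := by rw [← add_assoc, ENNReal.add_thirds]

end IsLogDerivFamily

theorem exists_measure_cons_mem_le {α : Type*} [MeasurableSpace α] (μ : Measure α)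
    [IsProbabilityMeasure μ] {P : α → Prop} (hP : ∀ᵐ x ∂μ, P x) {n : ℕ}
    (B : Set (Fin (n + 1) → α)) :
    ∃ z : Fin n → α, (∀ i, P (z i)) ∧
      μ {x | (Fin.cons x z : Fin (n + 1) → α) ∈ B} ≤ (Measure.pi fun _ : Fin (n + 1) => μ) B := by
  set B' := toMeasurable (Measure.pi fun _ : Fin (n + 1) => μ) B with hB'
  have hB'm : MeasurableSet B' := measurableSet_toMeasurable _ _
  set e := (MeasurableEquiv.piFinSuccAbove (fun _ : Fin (n + 1) => α) 0).symm with he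
  have hpre := ((measurePreserving_piFinSuccAbove (fun _ : Fin (n + 1) => μ) 0).symm)
    |>.measure_preimage
    hB'm.nullMeasurableSet
  have hem : MeasurableSet (e ⁻¹' B') := e.measurable hB'm
  have hPz : ∀ᵐ z ∂(Measure.pi fun _ : Fin n => μ), ∀ i, P (z i) := by
    rw [ae_all_iff]
    exact fun i => (Measure.quasiMeasurePreserving_eval (fun _ : Fin n => μ) i).ae hP
  obtain ⟨z, hz, hle⟩ := exists_notMem_null_le_lintegral
    (measurable_measure_prodMk_right (μ := μ) hem).aemeasurable
    (show (Measure.pi fun _ : Fin n => μ) {z | ¬ ∀ i, P (z i)} = 0 from hPz)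
  refine ⟨z, not_not.1 hz, ?_⟩
  rw [← Measure.prod_apply_symm hem] at hle
  rw [← measure_toMeasurable B, ← hB', ← hpre]
  refine (measure_mono fun x hx => ?_).trans hle
  have h1 : (Fin.cons x z : Fin (n + 1) → α) ∈ B' := subset_toMeasurable _ _ hx
  have h2 : e (x, z) = (Fin.cons x z : Fin (n + 1) → α) := Fin.insertNth_zero' x z
  show e (x, z) ∈ B'
  rwa [h2]

/-- If events have asymptotically vanishing probability, one can fix all but one observation of
suitable samples so that almost every value of the remaining observation eventually avoids them. -/
theorem exists_seq_ae_eventually_cons_notMem {α : Type*} [MeasurableSpace α] (μ : Measure α)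
    [IsProbabilityMeasure μ] {P : α → Prop} (hP : ∀ᵐ x ∂μ, P x)
    {B : ℕ → (n : ℕ) → Set (Fin n → α)}
    (hB : ∀ j, Tendsto (fun n => (Measure.pi fun _ : Fin n => μ) (B j n)) atTop (nhds 0)) :
    ∃ (N : ℕ → ℕ) (z : ∀ j, Fin (N j) → α), (∀ j, j ≤ N j) ∧ (∀ j i, P (z j i)) ∧
      ∀ᵐ x ∂μ, ∀ᶠ j in atTop, (Fin.cons x (z j) : Fin (N j + 1) → α) ∉ B j (N j + 1) := by
  have h1 : ∀ j : ℕ, ∃ n, j ≤ n ∧ (Measure.pi fun _ : Fin (n + 1) => μ) (B j (n + 1)) ≤ 2⁻¹ ^ j := by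
    intro j
    have := ((tendsto_add_atTop_iff_nat 1).2 (hB j))
    obtain ⟨n, hn, hn'⟩ := ((ENNReal.tendsto_nhds_zero.1 this (2⁻¹ ^ j)
      (by simp [ENNReal.pow_pos])).and
      (eventually_ge_atTop j)).exists
    exact ⟨n, hn', hn⟩
  choose N hN hN' using h1
  choose z hz hz' using fun j => exists_measure_cons_mem_le μ hP (B j (N j + 1))
  refine ⟨N, z, hN, hz, ae_eventually_notMem ?_⟩
  refine ne_top_of_le_ne_top ?_ (ENNReal.tsum_le_tsum fun j => (hz' j).trans (hN' j))
  rw [ENNReal.tsum_geometric]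
  simp

theorem ofReal_abs_sub_le_setLIntegral {φ φ' : ℝ → ℝ} {a b s t : ℝ}
    (hφ : ∀ u ∈ Set.Icc a b, HasDerivAt φ (φ' u) u) (hφ' : ContinuousOn φ' (Set.Icc a b))
    (hs : s ∈ Set.Icc a b) (ht : t ∈ Set.Icc a b) :
    ENNReal.ofReal |φ s - φ t| ≤ ∫⁻ u in Set.Icc a b, ENNReal.ofReal |φ' u| := by
  have hsub : Set.uIcc t s ⊆ Set.Icc a b := Set.uIcc_subset_Icc ht hs
  rw [← intervalIntegral.integral_eq_sub_of_hasDerivAt (fun u hu => hφ u (hsub hu))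
    ((hφ'.mono hsub).intervalIntegrable)]
  have h1 := intervalIntegral.norm_integral_le_integral_norm_uIoc (f := φ') (a := t) (b := s)
    (μ := volume)
  have hi : IntegrableOn φ' (Set.uIoc t s) :=
    (hφ'.integrableOn_Icc).mono_set (Set.uIoc_subset_uIcc.trans hsub)
  calc _ ≤ ENNReal.ofReal (∫ u in Set.uIoc t s, ‖φ' u‖) := ENNReal.ofReal_le_ofReal h1
    _ = ∫⁻ u in Set.uIoc t s, ENNReal.ofReal |φ' u| :=
      ofReal_integral_eq_lintegral_ofReal hi.norm (ae_of_all _ fun _ => norm_nonneg _)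
    _ ≤ _ := lintegral_mono_set (Set.uIoc_subset_uIcc.trans hsub)

theorem HasStrictDerivAt.sub_isBigO_sub {q : ℝ → ℝ} {q' c : ℝ} (hq : HasStrictDerivAt q q' c)
    (hq' : q' ≠ 0) {a b : ℕ → ℝ} (ha : Tendsto a atTop (nhds c)) (hb : Tendsto b atTop (nhds c)) :
    (fun j => a j - b j) =O[atTop] fun j => q (a j) - q (b j) :=
  (hq.isTheta_sub hq').isBigO_symm.comp_tendsto (ha.prodMk_nhds hb)

theorem HasStrictDerivAt.tendsto_mul_sub {q : ℝ → ℝ} {q' c : ℝ} (hq : HasStrictDerivAt q q' c)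
    (hq' : q' ≠ 0) {a b m : ℕ → ℝ} {d : ℝ} (ha : Tendsto a atTop (nhds c))
    (hb : Tendsto b atTop (nhds c)) (h : ∀ᶠ j in atTop, m j * (q (a j) - q (b j)) = d) :
    Tendsto (fun j => m j * (a j - b j)) atTop (nhds (d / q')) := by
  have h1 : (fun j => q (a j) - q (b j) - (a j - b j) * q') =o[atTop] fun j => a j - b j := by
    simpa [Function.comp_def] using hq.isLittleO.comp_tendsto (ha.prodMk_nhds hb)
  have h2 := (Asymptotics.isBigO_refl m atTop).mul_isLittleO
    (h1.trans_isBigO (hq.sub_isBigO_sub hq' ha hb))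
  have h3 : (fun j => m j * (q (a j) - q (b j) - (a j - b j) * q')) =o[atTop] fun _ => d :=
    h2.congr' (EventuallyEq.refl _ _) h
  have h4 : (fun j => m j * (q (a j) - q (b j) - (a j - b j) * q')) =o[atTop] fun _ => (1 : ℝ) :=
    h3.trans_isBigO (Asymptotics.isBigO_const_const d one_ne_zero atTop)
  have h5 := ((Asymptotics.isLittleO_one_iff ℝ).1 h4).const_sub d |>.div_const q'
  rw [sub_zero] at h5
  refine h5.congr' ?_
  filter_upwards [h] with j hj
  rw [mul_sub, hj]
  field_simp
  ring

namespace IsLogDerivFamily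

variable {𝒳 Θ : Set ℝ} {f l1 l2 l3 : ℝ → ℝ → ℝ}

/-- First-order expansion of the score of a sample, with a remainder controlled by the variation
of the second derivative of the log-likelihood. -/
theorem abs_sum_sub_sub_le (hf : IsLogDerivFamily 𝒳 Θ f l1 l2 l3) {n : ℕ} {z : Fin n → ℝ}
    (hz : ∀ i, z i ∈ 𝒳) {w k K : ℝ} (hK : 0 ≤ K) (hsub : Set.Icc (w - k) (w + k) ⊆ Θ)
    (hV : ∑ i, ∫⁻ s in Set.Icc (w - k) (w + k), ENNReal.ofReal |l3 (z i) s| ≤ ENNReal.ofReal K)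
    {u : ℝ} (hu : |u - w| ≤ k) :
    |∑ i, l1 (z i) u - ∑ i, l1 (z i) w - (∑ i, l2 (z i) w) * (u - w)| ≤ K * |u - w| := by
  have hk : 0 ≤ k := (abs_nonneg _).trans hu
  have hw' : w ∈ Set.Icc (w - k) (w + k) := ⟨by linarith, by linarith⟩
  have hu' : u ∈ Set.Icc (w - k) (w + k) :=
    ⟨by linarith [(abs_le.1 hu).1], by linarith [(abs_le.1 hu).2]⟩
  have hb : ∀ s ∈ Set.Icc (w - k) (w + k), |∑ i, l2 (z i) s - ∑ i, l2 (z i) w| ≤ K := by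
    intro s hs
    rw [← Finset.sum_sub_distrib]
    refine (Finset.abs_sum_le_sum_abs _ _).trans ?_
    rw [← ENNReal.ofReal_le_ofReal_iff hK, ENNReal.ofReal_sum_of_nonneg fun i _ => abs_nonneg _]
    refine (Finset.sum_le_sum fun i _ => ?_).trans hV
    exact ofReal_abs_sub_le_setLIntegral (fun v hv => hf.hasDerivAt_two _ (hz i) v (hsub hv))
      ((hf.continuousOn_three _ (hz i)).mono hsub) hs hw'
  have h := (convex_Icc (w - k) (w + k)).norm_image_sub_le_of_norm_hasDerivWithin_le
    (f := fun s => ∑ i, l1 (z i) s - (∑ i, l2 (z i) w) * s)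
    (f' := fun s => ∑ i, l2 (z i) s - (∑ i, l2 (z i) w) * 1)
    (fun s hs => ((hf.hasDerivAt_sum hz (hsub hs)).sub
      ((hasDerivAt_id s).const_mul _)).hasDerivWithinAt)
    (fun s hs => by rw [mul_one]; exact hb s hs) hw' hu'
  simp only [Real.norm_eq_abs] at h
  convert h using 2
  ring

theorem continuousAt_one (hf : IsLogDerivFamily 𝒳 Θ f l1 l2 l3) {x t : ℝ} (hx : x ∈ 𝒳)
    (ht : t ∈ Θ) : ContinuousAt (l1 x) t :=
  (hf.hasDerivAt_one x hx t ht).continuousAt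

/-- Linearization of the likelihood equations of two samples that differ in one observation. -/
theorem tendsto_sum_mul_sub (hf : IsLogDerivFamily 𝒳 Θ f l1 l2 l3) {c r : ℝ} (hr : 0 < r)
    (hsub : Set.Icc (c - r) (c + r) ⊆ Θ) {N : ℕ → ℕ} (hN : ∀ j, j ≤ N j)
    {z : ∀ j, Fin (N j) → ℝ} (hz : ∀ j i, z j i ∈ 𝒳) {u w : ℝ} (hu : u ∈ 𝒳) (hw : w ∈ 𝒳)
    {a b : ℕ → ℝ} (ha : Tendsto a atTop (nhds c)) (hb : Tendsto b atTop (nhds c)) {C d : ℝ}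
    (hd : Tendsto (fun j => ((N j : ℝ) + 1) * (a j - b j)) atTop (nhds d)) (hdC : |d| < C)
    (hau : ∀ᶠ j in atTop, l1 u (a j) + ∑ i, l1 (z j i) (a j) = 0)
    (hbw : ∀ᶠ j in atTop, l1 w (b j) + ∑ i, l1 (z j i) (b j) = 0)
    (hV : ∀ᶠ j in atTop, ∑ i, ∫⁻ s in Set.Icc (b j - C / ((N j : ℝ) + 1))
      (b j + C / ((N j : ℝ) + 1)), ENNReal.ofReal |l3 (z j i) s| ≤
        ENNReal.ofReal (1 / ((j : ℝ) + 1) * ((N j : ℝ) + 1))) :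
    Tendsto (fun j => (∑ i, l2 (z j i) (b j)) * (a j - b j)) atTop
      (nhds (l1 w c - l1 u c)) := by
  have hc : c ∈ Θ := hsub ⟨by linarith, by linarith⟩
  have hNt : Tendsto (fun j => C / ((N j : ℝ) + 1)) atTop (nhds 0) := by
    refine Tendsto.div_atTop tendsto_const_nhds ?_
    exact tendsto_atTop_add_const_right _ _
      (tendsto_natCast_atTop_atTop.comp (tendsto_atTop_mono hN tendsto_id))
  have hpos : ∀ j, (0 : ℝ) < (N j : ℝ) + 1 := fun j => by positivity
  have h1 : Tendsto (fun j => l1 w (b j) - l1 u (a j)) atTop (nhds (l1 w c - l1 u c)) :=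
    ((hf.continuousAt_one hw hc).tendsto.comp hb).sub ((hf.continuousAt_one hu hc).tendsto.comp ha)
  have hlow : Tendsto (fun j => b j - C / ((N j : ℝ) + 1)) atTop (nhds c) := by
    simpa using hb.sub hNt
  have hupp : Tendsto (fun j => b j + C / ((N j : ℝ) + 1)) atTop (nhds c) := by
    simpa using hb.add hNt
  have h0 : Tendsto (fun j : ℕ => 1 / ((j : ℝ) + 1) * |((N j : ℝ) + 1) * (a j - b j)|) atTop
      (nhds 0) := by
    simpa using tendsto_one_div_add_atTop_nhds_zero_nat.mul hd.abs
  have h2 : Tendsto (fun j => ∑ i, l1 (z j i) (a j) - ∑ i, l1 (z j i) (b j)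
      - (∑ i, l2 (z j i) (b j)) * (a j - b j)) atTop (nhds 0) := by
    refine squeeze_zero_norm' ?_ h0
    filter_upwards [hV, hlow.eventually (lt_mem_nhds (show c - r < c by linarith)),
      hupp.eventually (gt_mem_nhds (show c < c + r by linarith)),
      hd.abs.eventually (gt_mem_nhds hdC)] with j hj hjl hju hjd
    have hn := hpos j
    rw [abs_mul, abs_of_pos hn] at hjd
    have h := hf.abs_sum_sub_sub_le (hz j) (by positivity)
      ((Set.Icc_subset_Icc hjl.le hju.le).trans hsub) hj
      (u := a j) (by rw [le_div_iff₀ hn]; linarith)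
    rw [Real.norm_eq_abs, abs_mul, abs_of_pos hn, ← mul_assoc]
    exact h
  have h3 := h1.sub h2
  rw [sub_zero] at h3
  refine h3.congr' ?_
  filter_upwards [hau, hbw] with j h4 h5
  linarith

/-- If a regular function of the maximum likelihood estimator is asymptotically the sample mean of
`g`, then the score at the true parameter is an affine function of `g`. -/
theorem exists_ae_score_relation (hf : IsLogDerivFamily 𝒳 Θ f l1 l2 l3) {c r : ℝ} (hr : 0 < r)
    (hsub : Set.Icc (c - r) (c + r) ⊆ Θ) {M : ENNReal} (hMt : M ≠ ⊤)
    (hM2 : ∀ s ∈ Set.Icc (c - r) (c + r),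
      ∫⁻ x, ENNReal.ofReal |l2 x s| ∂densityMeasure 𝒳 f s ≤ M)
    (hM3 : ∀ s ∈ Set.Icc (c - r) (c + r),
      ∫⁻ x, ENNReal.ofReal |l3 x s| ∂densityMeasure 𝒳 f s ≤ M)
    {τ : (n : ℕ) → (Fin n → ℝ) → ℝ}
    (hτ : ∀ n x, (∀ i, x i ∈ 𝒳) → ∏ i, f (x i) c ≤ ∏ i, f (x i) (τ n x))
    (hcrit : ∀ n x, (∀ i, x i ∈ 𝒳) → τ n x ∈ Θ → ∑ i, l1 (x i) (τ n x) = 0)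
    (hcons : ∀ δ : ℝ, 0 < δ → Tendsto (fun n =>
      (Measure.pi fun _ : Fin n => densityMeasure 𝒳 f c) {x | δ < |τ n x - c|}) atTop (nhds 0))
    {q : ℝ → ℝ} {q' : ℝ} (hq : HasStrictDerivAt q q' c) (hq' : q' ≠ 0) {g : ℝ → ℝ}
    {E : (n : ℕ) → Set (Fin n → ℝ)}
    (hE : Tendsto (fun n => (Measure.pi fun _ : Fin n => densityMeasure 𝒳 f c) (E n)ᶜ)
      atTop (nhds 0))
    (hqg : ∀ n : ℕ, 1 ≤ n → ∀ x ∈ E n, q (τ n x) = (1 / (n : ℝ)) * ∑ i, g (x i)) :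
    ∃ G : Set ℝ, G ⊆ 𝒳 ∧ (∀ᵐ x ∂volume.restrict 𝒳, x ∈ G) ∧ ∀ u ∈ G, ∀ v ∈ G, ∀ w ∈ G,
      (g u = g w → l1 u c = l1 w c) ∧
      (l1 u c - l1 w c) * (g v - g w) = (l1 v c - l1 w c) * (g u - g w) := by
  have hc : c ∈ Θ := hsub ⟨by linarith, by linarith⟩
  have hprob := hf.isProbabilityMeasure hc
  have hP : ∀ᵐ x ∂densityMeasure 𝒳 f c, x ∈ 𝒳 :=
    (withDensity_absolutelyContinuous _ _).ae_le (ae_restrict_mem hf.measurableSet)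
  set B : ℕ → ℕ → (n : ℕ) → Set (Fin n → ℝ) := fun k j n =>
    ((E n)ᶜ ∪ {x | 1 / ((j : ℝ) + 1) < |τ n x - c|}) ∪
      {x | ENNReal.ofReal (1 / ((j : ℝ) + 1) * n) ≤ ∑ i, ∫⁻ s in
        Set.Icc (τ n x - ((k : ℝ) + 1) / n) (τ n x + ((k : ℝ) + 1) / n),
          ENNReal.ofReal |l3 (x i) s|} with hBdef
  have key := fun k : ℕ => exists_seq_ae_eventually_cons_notMem (densityMeasure 𝒳 f c) hP (B := B k)
    (fun j => by
      have e1 := hcons (1 / ((j : ℝ) + 1)) (by positivity)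
      have e2 := hf.tendsto_measure_variation_at_argmax hr hsub hMt hM2 hM3 hτ hcons
        (C := (k : ℝ) + 1) (ε := 1 / ((j : ℝ) + 1)) (by positivity) (by positivity)
      have e3 := (hE.add e1).add e2
      rw [add_zero, add_zero] at e3
      exact tendsto_of_tendsto_of_tendsto_of_le_of_le tendsto_const_nhds e3
        (fun _ => bot_le) fun n => (measure_union_le _ _).trans
          (add_le_add_left (measure_union_le _ _) _))
  choose N z hN hz hae using key
  have hae' := (ae_all_iff.2 hae).and hP
  refine ⟨{x | (∀ k, ∀ᶠ j in atTop,
      (Fin.cons x (z k j) : Fin (N k j + 1) → ℝ) ∉ B k j (N k j + 1)) ∧ x ∈ 𝒳},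
    fun x hx => hx.2, ?_, ?_⟩
  · rw [densityMeasure, ae_withDensity_iff (hf.measurable_density_left c)] at hae'
    filter_upwards [hae', ae_restrict_mem hf.measurableSet] with x hx hx𝒳
    exact hx (ENNReal.ofReal_pos.2 (hf.pos x hx𝒳 c hc)).ne'
  intro u hu v hv w hw
  obtain ⟨k, hk⟩ := exists_nat_gt (max |(g u - g w) / q'| |(g v - g w) / q'|)
  have hku : |(g u - g w) / q'| < (k : ℝ) + 1 := by
    linarith [le_max_left |(g u - g w) / q'| |(g v - g w) / q'|]
  have hkv : |(g v - g w) / q'| < (k : ℝ) + 1 := by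
    linarith [le_max_right |(g u - g w) / q'| |(g v - g w) / q'|]
  set a : ℝ → ℕ → ℝ := fun x j => τ (N k j + 1) (Fin.cons x (z k j)) with ha
  have hmem : ∀ x ∈ 𝒳, ∀ j i, (Fin.cons x (z k j) : Fin (N k j + 1) → ℝ) i ∈ 𝒳 := by
    intro x hx j i
    refine Fin.cases ?_ (fun i => ?_) i
    · simpa using hx
    · simpa using hz k j i
  have facts : ∀ x, ((∀ k, ∀ᶠ j in atTop,
        (Fin.cons x (z k j) : Fin (N k j + 1) → ℝ) ∉ B k j (N k j + 1)) ∧ x ∈ 𝒳) →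
      Tendsto (a x) atTop (nhds c) ∧
      (∀ᶠ j in atTop, l1 x (a x j) + ∑ i, l1 (z k j i) (a x j) = 0) ∧
      (∀ᶠ j in atTop, ((N k j : ℝ) + 1) * q (a x j) = g x + ∑ i, g (z k j i)) ∧
      (∀ᶠ j in atTop, ∑ i, ∫⁻ s in Set.Icc (a x j - ((k : ℝ) + 1) / ((N k j : ℝ) + 1))
        (a x j + ((k : ℝ) + 1) / ((N k j : ℝ) + 1)), ENNReal.ofReal |l3 (z k j i) s| ≤
          ENNReal.ofReal (1 / ((j : ℝ) + 1) * ((N k j : ℝ) + 1))) := by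
    rintro x ⟨hx, hx𝒳⟩
    have hx := hx k
    have hxt : Tendsto (a x) atTop (nhds c) := by
      rw [tendsto_iff_dist_tendsto_zero]
      refine squeeze_zero' (Eventually.of_forall fun _ => dist_nonneg) ?_
        tendsto_one_div_add_atTop_nhds_zero_nat
      filter_upwards [hx] with j hj
      simp only [hBdef, Set.mem_union, not_or, Set.mem_ofPred_eq, not_lt] at hj
      exact hj.1.2
    refine ⟨hxt, ?_, ?_, ?_⟩
    · filter_upwards [hxt.eventually (Icc_mem_nhds (show c - r < c by linarith)
        (show c < c + r by linarith))] with j hj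
      have := hcrit _ _ (hmem x hx𝒳 j) (hsub hj)
      rwa [Fin.sum_univ_succ] at this
    · filter_upwards [hx] with j hj
      simp only [hBdef, Set.mem_union, not_or, Set.mem_compl_iff, not_not] at hj
      have := hqg _ (Nat.le_add_left _ _) _ hj.1.1
      rw [Fin.sum_univ_succ] at this
      simp only [Fin.cons_zero, Fin.cons_succ] at this
      rw [ha]
      simp only
      rw [this]
      push_cast
      field_simp
    · filter_upwards [hx] with j hj
      simp only [hBdef, Set.mem_union, not_or, Set.mem_ofPred_eq, not_le] at hj
      have := hj.2
      push_cast at this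
      rw [Fin.sum_univ_succ] at this
      simp only [Fin.cons_zero, Fin.cons_succ] at this
      exact le_add_self.trans this.le
  obtain ⟨hut, hus, huq, -⟩ := facts u hu
  obtain ⟨hvt, hvs, hvq, -⟩ := facts v hv
  obtain ⟨hwt, hws, hwq, hwV⟩ := facts w hw
  have hdu : ∀ᶠ j in atTop, ((N k j : ℝ) + 1) * (q (a u j) - q (a w j)) = g u - g w := by
    filter_upwards [huq, hwq] with j h1 h2
    rw [mul_sub, h1, h2]; ring
  have hdv : ∀ᶠ j in atTop, ((N k j : ℝ) + 1) * (q (a v j) - q (a w j)) = g v - g w := by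
    filter_upwards [hvq, hwq] with j h1 h2
    rw [mul_sub, h1, h2]; ring
  have hlu := hq.tendsto_mul_sub hq' hut hwt hdu
  have hlv := hq.tendsto_mul_sub hq' hvt hwt hdv
  have hAu := hf.tendsto_sum_mul_sub hr hsub (hN k) (hz k) hu.2 hw.2 hut hwt hlu hku hus hws hwV
  have hAv := hf.tendsto_sum_mul_sub hr hsub (hN k) (hz k) hv.2 hw.2 hvt hwt hlv hkv hvs hws hwV
  constructor
  · intro hg
    have h1 : (fun j => a u j - a w j) =ᶠ[atTop] 0 := by
      refine ((hq.sub_isBigO_sub hq' hut hwt).congr' EventuallyEq.rfl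
        (g₂ := fun _ => (0 : ℝ)) ?_).eq_zero_imp.mono fun j hj => hj rfl
      filter_upwards [hdu] with j hj
      rw [hg, sub_self] at hj
      exact (mul_eq_zero.1 hj).resolve_left (by positivity)
    have h2 := tendsto_nhds_unique (hAu.congr' (h1.mono fun j hj => by
      simp only at hj ⊢; rw [hj]; exact mul_zero _)) tendsto_const_nhds
    linarith
  · have h1 := tendsto_nhds_unique (hAu.mul hlv) ((hAv.mul hlu).congr fun j => by ring)
    field_simp at h1
    linarith

end IsLogDerivFamily

/-- A finite function that is sequentially lower semicontinuous on an open set is bounded on small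
intervals arbitrarily close to any given point. -/
theorem exists_Icc_le_of_le_liminf {Θ V : Set ℝ} (hV : IsOpen V) (hVΘ : V ⊆ Θ) (hne : V.Nonempty)
    {e : ℝ → ENNReal} (hfin : ∀ t ∈ Θ, e t ≠ ⊤)
    (hlsc : ∀ (t : ℕ → ℝ) (s : ℝ), (∀ k, t k ∈ Θ) → s ∈ Θ → Tendsto t atTop (nhds s) →
      e s ≤ liminf (fun k => e (t k)) atTop) :
    ∃ c r : ℝ, 0 < r ∧ Set.Icc (c - r) (c + r) ⊆ V ∧ ∃ M : ENNReal, M ≠ ⊤ ∧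
      ∀ s ∈ Set.Icc (c - r) (c + r), e s ≤ M := by
  obtain ⟨θ, hθ⟩ := hne
  obtain ⟨ρ, hρ, hball⟩ := (Metric.nhds_basis_closedBall.mem_iff).1 (hV.mem_nhds hθ)
  rw [Real.closedBall_eq_Icc] at hball
  set F : ℕ → Set ℝ := fun n =>
    {t | t ∈ Set.Icc (θ - ρ) (θ + ρ) ∧ e t ≤ n} ∪ (Set.Ioo (θ - ρ) (θ + ρ))ᶜ with hF
  have hclosed : ∀ n, IsClosed (F n) := by
    intro n
    refine IsClosed.union (IsSeqClosed.isClosed fun t s ht hts => ?_) isOpen_Ioo.isClosed_compl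
    have hs : s ∈ Set.Icc (θ - ρ) (θ + ρ) :=
      isClosed_Icc.mem_of_tendsto hts (Eventually.of_forall fun k => (ht k).1)
    refine ⟨hs, (hlsc t s (fun k => hVΘ (hball (ht k).1)) (hVΘ (hball hs)) hts).trans ?_⟩
    exact liminf_le_of_le (by isBoundedDefault) fun b hb => by
      obtain ⟨k, hk⟩ := hb.exists
      exact hk.trans (ht k).2
  have hcover : ⋃ n, F n = Set.univ := by
    refine Set.eq_univ_of_forall fun t => Set.mem_iUnion.2 ?_
    by_cases ht : t ∈ Set.Ioo (θ - ρ) (θ + ρ)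
    · have ht' := Set.Ioo_subset_Icc_self ht
      obtain ⟨n, hn⟩ := ENNReal.exists_nat_gt (hfin t (hVΘ (hball ht')))
      exact ⟨n, Or.inl ⟨ht', hn.le⟩⟩
    · exact ⟨0, Or.inr ht⟩
  obtain ⟨c, hc, hcF⟩ := (dense_iUnion_interior_of_closed hclosed hcover).inter_open_nonempty
    (Set.Ioo (θ - ρ) (θ + ρ)) isOpen_Ioo ⟨θ, by linarith, by linarith⟩
  obtain ⟨n, hcn⟩ := Set.mem_iUnion.1 hcF
  obtain ⟨r, hr, hsub⟩ := (Metric.nhds_basis_closedBall.mem_iff).1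
    ((isOpen_interior.inter isOpen_Ioo).mem_nhds (⟨hcn, hc⟩ :
      c ∈ interior (F n) ∩ Set.Ioo (θ - ρ) (θ + ρ)))
  rw [Real.closedBall_eq_Icc] at hsub
  refine ⟨c, r, hr, fun s hs => hball (Set.Ioo_subset_Icc_self (hsub hs).2), n,
    ENNReal.natCast_ne_top n, fun s hs => ?_⟩
  rcases interior_subset (hsub hs).1 with h | h
  · exact h.2
  · exact absurd (hsub hs).2 h

theorem lintegral_le_liminf_of_tendsto {α : Type*} [MeasurableSpace α] {μ : Measure α}
    {F : ℕ → α → ENNReal} {G : α → ENNReal} (hF : ∀ k, Measurable (F k))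
    (h : ∀ᵐ x ∂μ, Tendsto (fun k => F k x) atTop (nhds (G x))) :
    ∫⁻ x, G x ∂μ ≤ liminf (fun k => ∫⁻ x, F k x ∂μ) atTop :=
  (lintegral_mono_ae (h.mono fun _ hx => hx.liminf_eq.ge)).trans (lintegral_liminf_le hF)

theorem mem_closure_of_ae_mem {𝒳 G : Set ℝ} (h𝒳 : IsOpen 𝒳)
    (hG : ∀ᵐ x ∂volume.restrict 𝒳, x ∈ G) {x : ℝ} (hx : x ∈ 𝒳) : x ∈ closure (G ∩ 𝒳) := by
  rw [_root_.mem_closure_iff]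
  intro V hV hxV
  have hdense := Measure.dense_of_ae ((ae_restrict_iff' h𝒳.measurableSet).1 hG)
  obtain ⟨y, hy, hyG⟩ := hdense.inter_open_nonempty (V ∩ 𝒳) (hV.inter h𝒳) ⟨x, hxV, hx⟩
  exact ⟨y, hy.1, hyG hy.2, hy.2⟩

namespace IsLogDerivFamily

variable {𝒳 Θ : Set ℝ} {f l1 l2 l3 : ℝ → ℝ → ℝ}

/-- Locally uniform integrability of the second and third log-derivatives holds near a dense set of
parameters. -/
theorem exists_Icc_lintegral_le (hf : IsLogDerivFamily 𝒳 Θ f l1 l2 l3) {V : Set ℝ} (hV : IsOpen V)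
    (hΘ : IsOpen Θ)
    (hVΘ : V ⊆ Θ) (hne : V.Nonempty)
    (h2 : ∀ s ∈ Θ, ∫⁻ x, ENNReal.ofReal |l2 x s| ∂densityMeasure 𝒳 f s ≠ ⊤)
    (h3 : ∀ s ∈ Θ, ∫⁻ x, ENNReal.ofReal |l3 x s| ∂densityMeasure 𝒳 f s ≠ ⊤) :
    ∃ c r : ℝ, 0 < r ∧ Set.Icc (c - r) (c + r) ⊆ V ∧ ∃ M : ENNReal, M ≠ ⊤ ∧
      (∀ s ∈ Set.Icc (c - r) (c + r),
        ∫⁻ x, ENNReal.ofReal |l2 x s| ∂densityMeasure 𝒳 f s ≤ M) ∧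
      ∀ s ∈ Set.Icc (c - r) (c + r),
        ∫⁻ x, ENNReal.ofReal |l3 x s| ∂densityMeasure 𝒳 f s ≤ M := by
  have hm2 : ∀ s, Measurable fun x => ENNReal.ofReal |l2 x s| := fun s =>
    ENNReal.measurable_ofReal.comp
      (hf.measurable_two.comp (measurable_id.prodMk measurable_const)).abs
  have hm3 : ∀ s, Measurable fun x => ENNReal.ofReal |l3 x s| := fun s =>
    ENNReal.measurable_ofReal.comp
      (hf.measurable_three.comp (measurable_id.prodMk measurable_const)).abs
  have hl : ∀ s, ∫⁻ x, (ENNReal.ofReal |l2 x s| + ENNReal.ofReal |l3 x s|) ∂densityMeasure 𝒳 f s =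
      ∫⁻ x in 𝒳, ENNReal.ofReal (f x s) * (ENNReal.ofReal |l2 x s| + ENNReal.ofReal |l3 x s|) :=
    fun s => hf.lintegral_densityMeasure s ((hm2 s).add (hm3 s))
  obtain ⟨c, r, hr, hsub, M, hM, hle⟩ := exists_Icc_le_of_le_liminf hV hVΘ hne
    (e := fun s => ∫⁻ x, (ENNReal.ofReal |l2 x s| + ENNReal.ofReal |l3 x s|) ∂densityMeasure 𝒳 f s)
    (fun s hs => by
      rw [lintegral_add_left (hm2 s)]
      exact ENNReal.add_ne_top.2 ⟨h2 s hs, h3 s hs⟩)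
    (fun t s ht hs hts => by
      simp only [hl]
      refine lintegral_le_liminf_of_tendsto
        (fun k => (hf.measurable_density_left _).mul ((hm2 _).add (hm3 _))) ?_
      filter_upwards [ae_restrict_mem hf.measurableSet] with x hx
      have c1 : Tendsto (fun k => f x (t k)) atTop (nhds (f x s)) :=
        (hf.hasDerivAt_density x hx s hs).continuousAt.tendsto.comp hts
      have c2 : Tendsto (fun k => l2 x (t k)) atTop (nhds (l2 x s)) :=
        (hf.hasDerivAt_two x hx s hs).continuousAt.tendsto.comp hts
      have c3 : Tendsto (fun k => l3 x (t k)) atTop (nhds (l3 x s)) :=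
        ((hf.continuousOn_three x hx).continuousAt (hΘ.mem_nhds hs)).tendsto.comp hts
      refine ENNReal.Tendsto.mul (ENNReal.tendsto_ofReal c1) (Or.inr ?_)
        ((ENNReal.tendsto_ofReal c2.abs).add (ENNReal.tendsto_ofReal c3.abs))
        (Or.inr ENNReal.ofReal_ne_top)
      exact ENNReal.add_ne_top.2 ⟨ENNReal.ofReal_ne_top, ENNReal.ofReal_ne_top⟩)
  refine ⟨c, r, hr, hsub, M, hM, fun s hs => ?_, fun s hs => ?_⟩
  · exact (lintegral_mono fun _ => le_self_add).trans (hle s hs)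
  · exact (lintegral_mono fun _ => le_add_self).trans (hle s hs)

end IsLogDerivFamily

theorem eq_zero_of_subset_closure {S X : Set ℝ} (hSX : S ⊆ X) (hX : X ⊆ closure S) {φ : ℝ → ℝ}
    (hφ : ContinuousOn φ X) (h : ∀ x ∈ S, φ x = 0) : ∀ x ∈ X, φ x = 0 :=
  Set.EqOn.of_subset_closure (g := fun _ => (0 : ℝ)) h hφ continuousOn_const hSX hX

theorem eq_of_hasDerivAt_zero {Θ : Set ℝ} (hΘ : IsOpen Θ) (hΘ' : Θ.OrdConnected) {φ : ℝ → ℝ}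
    (h : ∀ t ∈ Θ, HasDerivAt φ 0 t) {s t : ℝ} (hs : s ∈ Θ) (ht : t ∈ Θ) : φ s = φ t :=
  hΘ.is_const_of_deriv_eq_zero hΘ'.isPreconnected
    (fun t ht => (h t ht).differentiableAt.differentiableWithinAt)
    (fun t ht => (h t ht).deriv) hs ht

/-- Functions satisfying the affine relation of the scores along a dense set have rank one. -/
theorem cross_relation_of_dense {𝒳 S : Set ℝ} (hS : S ⊆ 𝒳) (h𝒳 : 𝒳 ⊆ closure S) {A B : ℝ → ℝ}
    (hA : ContinuousOn A 𝒳) (hB : ContinuousOn B 𝒳)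
    (h : ∀ u ∈ S, ∀ v ∈ S, ∀ w ∈ S, (A u - A w) * (B v - B w) - (A v - A w) * (B u - B w) = 0) :
    ∀ u ∈ 𝒳, ∀ v ∈ 𝒳, ∀ w ∈ 𝒳, (A u - A w) * (B v - B w) - (A v - A w) * (B u - B w) = 0 := by
  have h1 : ∀ v ∈ S, ∀ w ∈ S, ∀ u ∈ 𝒳,
      (A u - A w) * (B v - B w) - (A v - A w) * (B u - B w) = 0 := fun v hv w hw =>
    eq_zero_of_subset_closure hS h𝒳 (by fun_prop) fun u hu => h u hu v hv w hw
  have h2 : ∀ u ∈ 𝒳, ∀ w ∈ S, ∀ v ∈ 𝒳,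
      (A u - A w) * (B v - B w) - (A v - A w) * (B u - B w) = 0 := fun u hu w hw =>
    eq_zero_of_subset_closure hS h𝒳 (by fun_prop) fun v hv => h1 v hv w hw u hu
  exact fun u hu v hv => eq_zero_of_subset_closure hS h𝒳 (by fun_prop)
    fun w hw => h2 u hu w hw v hv

/-- A log-likelihood whose scores are, for a dense set of parameters, almost everywhere affine in a
fixed function `g` is that of an exponential family. -/
theorem exists_eq_mul_add_of_score_relation {𝒳 Θ U : Set ℝ} (hΘopen : IsOpen Θ)
    (hΘconn : Θ.OrdConnected) (hΘne : Θ.Nonempty) (h𝒳open : IsOpen 𝒳) (h𝒳ne : 𝒳.Nonempty)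
    {ℓ L : ℝ → ℝ → ℝ} (hℓ : ∀ x ∈ 𝒳, ∀ t ∈ Θ, HasDerivAt (ℓ x) (L x t) t)
    (hLx : ∀ t ∈ Θ, ContinuousOn (fun x => L x t) 𝒳) (hLt : ∀ x ∈ 𝒳, ContinuousOn (L x) Θ)
    (hU : U ⊆ Θ) (hUd : Θ ⊆ closure U) {g : ℝ → ℝ}
    (hrel : ∀ c ∈ U, ∃ G : Set ℝ, G ⊆ 𝒳 ∧ (∀ᵐ x ∂volume.restrict 𝒳, x ∈ G) ∧
      ∀ u ∈ G, ∀ v ∈ G, ∀ w ∈ G, (g u = g w → L u c = L w c) ∧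
        (L u c - L w c) * (g v - g w) = (L v c - L w c) * (g u - g w)) :
    ∃ w c T h : ℝ → ℝ, ∀ θ ∈ Θ, ∀ x ∈ 𝒳, ℓ x θ = w θ * T x + c θ + h x := by
  obtain ⟨θ₀, hθ₀⟩ := hΘne
  obtain ⟨x₀, hx₀⟩ := h𝒳ne
  by_cases hcase : ∀ c ∈ U, ∀ x ∈ 𝒳, L x c - L x₀ c = 0
  · have h1 : ∀ x ∈ 𝒳, ∀ t ∈ Θ, L x t - L x₀ t = 0 := fun x hx =>
      eq_zero_of_subset_closure hU hUd ((hLt x hx).sub (hLt x₀ hx₀)) fun c hc => hcase c hc x hx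
    refine ⟨0, ℓ x₀, 0, fun x => ℓ x θ₀ - ℓ x₀ θ₀, fun θ hθ x hx => ?_⟩
    have h2 := eq_of_hasDerivAt_zero hΘopen hΘconn (φ := fun t => ℓ x t - ℓ x₀ t)
      (fun t ht => ((hℓ x hx t ht).sub (hℓ x₀ hx₀ t ht)).congr_deriv (h1 x hx t ht)) hθ hθ₀
    simp only [Pi.zero_apply] at h2 ⊢
    linarith
  · push Not at hcase
    obtain ⟨c₀, hc₀, y₀, hy₀, hne⟩ := hcase
    obtain ⟨G₀, hG₀, hG₀ae, hG₀rel⟩ := hrel c₀ hc₀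
    have hdense : ∀ S ⊆ 𝒳, (∀ᵐ x ∂volume.restrict 𝒳, x ∈ S) → 𝒳 ⊆ closure S := fun S hS hae x hx =>
      closure_mono Set.inter_subset_left (mem_closure_of_ae_mem h𝒳open hae hx)
    have hpair : ∃ v ∈ G₀, ∃ w ∈ G₀, L v c₀ ≠ L w c₀ := by
      by_contra! hcon
      obtain ⟨w, hw⟩ : G₀.Nonempty := closure_nonempty_iff.1 ⟨x₀, hdense G₀ hG₀ hG₀ae hx₀⟩
      have h1 := eq_zero_of_subset_closure hG₀ (hdense G₀ hG₀ hG₀ae)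
        ((hLx c₀ (hU hc₀)).sub (continuousOn_const (c := L w c₀)))
        (fun x hx => sub_eq_zero.2 (hcon x hx w hw))
      have h2 := h1 x₀ hx₀
      have h3 := h1 y₀ hy₀
      simp only [Pi.sub_apply] at h2 h3
      exact hne (by linarith)
    obtain ⟨v₁, hv₁, w₁, hw₁, hne₁⟩ := hpair
    have hg₁ : g v₁ - g w₁ ≠ 0 := fun h0 =>
      hne₁ ((hG₀rel v₁ hv₁ v₁ hv₁ w₁ hw₁).1 (sub_eq_zero.1 h0))
    have haff : ∀ u ∈ G₀, L u c₀ = L w₁ c₀ +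
        (L v₁ c₀ - L w₁ c₀) / (g v₁ - g w₁) * (g u - g w₁) := by
      intro u hu
      have := (hG₀rel u hu v₁ hv₁ w₁ hw₁).2
      field_simp
      linarith
    have hcrossU : ∀ c ∈ U, ∀ u ∈ 𝒳, ∀ v ∈ 𝒳, ∀ w ∈ 𝒳,
        (L u c - L w c) * (L v c₀ - L w c₀) - (L v c - L w c) * (L u c₀ - L w c₀) = 0 := by
      intro c hc
      obtain ⟨G, hG, hGae, hGrel⟩ := hrel c hc
      refine cross_relation_of_dense (S := G ∩ G₀) (Set.inter_subset_left.trans hG)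
        (hdense _ (Set.inter_subset_left.trans hG) (hGae.and hG₀ae)) (hLx c (hU hc))
        (hLx c₀ (hU hc₀)) fun u hu v hv w hw => ?_
      rw [haff u hu.2, haff v hv.2, haff w hw.2]
      linear_combination (L v₁ c₀ - L w₁ c₀) / (g v₁ - g w₁) *
        (hGrel u hu.1 v hv.1 w hw.1).2
    have hcross : ∀ u ∈ 𝒳, ∀ t ∈ Θ,
        (L u t - L x₀ t) * (L y₀ c₀ - L x₀ c₀) - (L y₀ t - L x₀ t) * (L u c₀ - L x₀ c₀) = 0 := by
      intro u hu
      have := hLt u hu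
      have := hLt x₀ hx₀
      have := hLt y₀ hy₀
      exact eq_zero_of_subset_closure hU hUd (by fun_prop)
        fun c hc => hcrossU c hc u hu y₀ hy₀ x₀ hx₀
    set T : ℝ → ℝ := fun u => (L u c₀ - L x₀ c₀) / (L y₀ c₀ - L x₀ c₀) with hT
    refine ⟨fun t => ℓ y₀ t - ℓ x₀ t, ℓ x₀, T,
      fun u => ℓ u θ₀ - ℓ x₀ θ₀ - (ℓ y₀ θ₀ - ℓ x₀ θ₀) * T u, fun θ hθ u hu => ?_⟩
    have h2 := eq_of_hasDerivAt_zero hΘopen hΘconn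
      (φ := fun t => ℓ u t - ℓ x₀ t - (ℓ y₀ t - ℓ x₀ t) * T u)
      (fun t ht => (((hℓ u hu t ht).sub (hℓ x₀ hx₀ t ht)).sub
        (((hℓ y₀ hy₀ t ht).sub (hℓ x₀ hx₀ t ht)).mul_const (T u))).congr_deriv (by
          have := hcross u hu t ht
          rw [hT]
          simp only
          field_simp
          linarith)) hθ hθ₀
    simp only at h2 ⊢
    linarith

theorem ContDiffOn.hasDerivAt_snd {D : Set (ℝ × ℝ)} (hD : IsOpen D) {F : ℝ × ℝ → ℝ} {n : WithTop ℕ∞}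
    (hF : ContDiffOn ℝ n F D) (hn : n ≠ 0) {x t : ℝ} (h : (x, t) ∈ D) :
    HasDerivAt (fun s => F (x, s)) (fderiv ℝ F (x, t) (0, 1)) t := by
  have h1 := ((hF.differentiableOn hn).differentiableAt (hD.mem_nhds h)).hasFDerivAt
  exact h1.comp_hasDerivAt t ((hasDerivAt_const t x).prodMk (hasDerivAt_id t))

theorem ContDiffOn.deriv_snd {D : Set (ℝ × ℝ)} (hD : IsOpen D) {F : ℝ × ℝ → ℝ}
    {m n : WithTop ℕ∞} (hF : ContDiffOn ℝ n F D) (hmn : m + 1 ≤ n) :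
    ContDiffOn ℝ m (fun z : ℝ × ℝ => deriv (fun s => F (z.1, s)) z.2) D := by
  have hn : n ≠ 0 := by
    rintro rfl
    simp at hmn
  refine ((hF.fderiv_of_isOpen hD hmn).clm_apply
    (contDiffOn_const (c := ((0 : ℝ), (1 : ℝ))))).congr fun z hz => ?_
  exact (hF.hasDerivAt_snd hD hn (x := z.1) (t := z.2) hz).deriv

/-- Extension by zero of a function of two variables from a product set. -/
noncomputable def zeroExtend (𝒳 Θ : Set ℝ) (φ : ℝ → ℝ → ℝ) (x t : ℝ) : ℝ :=
  (𝒳 ×ˢ Θ).indicator (Function.uncurry φ) (x, t)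

theorem zeroExtend_eq {𝒳 Θ : Set ℝ} (φ : ℝ → ℝ → ℝ) {x t : ℝ} (hx : x ∈ 𝒳) (ht : t ∈ Θ) :
    zeroExtend 𝒳 Θ φ x t = φ x t :=
  Set.indicator_of_mem (Set.mk_mem_prod hx ht) _

theorem measurable_zeroExtend {𝒳 Θ : Set ℝ} (h𝒳 : IsOpen 𝒳) (hΘ : IsOpen Θ) {φ : ℝ → ℝ → ℝ}
    (hφ : ContinuousOn (Function.uncurry φ) (𝒳 ×ˢ Θ)) :
    Measurable (Function.uncurry (zeroExtend 𝒳 Θ φ)) := by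
  classical
  have h := hφ.measurable_piecewise (continuousOn_const (c := (0 : ℝ))) (h𝒳.prod hΘ).measurableSet
  change Measurable ((𝒳 ×ˢ Θ).piecewise (Function.uncurry φ) 0) at h
  rw [Set.piecewise_eq_indicator] at h
  exact h

theorem hasDerivAt_zeroExtend {𝒳 Θ : Set ℝ} (hΘ : IsOpen Θ) {φ : ℝ → ℝ → ℝ} {x t d : ℝ} (hx : x ∈ 𝒳)
    (ht : t ∈ Θ) (h : HasDerivAt (φ x) d t) : HasDerivAt (zeroExtend 𝒳 Θ φ x) d t :=
  h.congr_of_eventuallyEq ((hΘ.eventually_mem ht).mono fun _ hs => zeroExtend_eq φ hx hs)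

/-- A smooth family of positive densities restricts to a family with log-derivatives. -/
theorem isLogDerivFamily_zeroExtend {𝒳 Θ : Set ℝ} (h𝒳 : IsOpen 𝒳) (hΘ : IsOpen Θ)
    {p l1 l2 l3 : ℝ → ℝ → ℝ} (hppos : ∀ θ ∈ Θ, ∀ x ∈ 𝒳, 0 < p θ x)
    (hpint : ∀ θ ∈ Θ, ∫ x in 𝒳, p θ x = 1)
    (h1 : ∀ x θ, l1 x θ = deriv (fun t => Real.log (p t x)) θ)
    (h2 : ∀ x θ, l2 x θ = deriv (l1 x) θ) (h3 : ∀ x θ, l3 x θ = deriv (l2 x) θ)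
    (hsmooth : ContDiffOn ℝ 4 (fun q : ℝ × ℝ => Real.log (p q.2 q.1)) (𝒳 ×ˢ Θ)) :
    ContinuousOn (Function.uncurry l1) (𝒳 ×ˢ Θ) ∧
    (∀ x ∈ 𝒳, ∀ t ∈ Θ, HasDerivAt (fun t => Real.log (p t x)) (l1 x t) t) ∧
    IsLogDerivFamily 𝒳 Θ (zeroExtend 𝒳 Θ fun x t => p t x) (zeroExtend 𝒳 Θ l1)
      (zeroExtend 𝒳 Θ l2) (zeroExtend 𝒳 Θ l3) := by
  have hD : IsOpen (𝒳 ×ˢ Θ) := h𝒳.prod hΘ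
  have e1 : Function.uncurry l1 =
      fun z : ℝ × ℝ => deriv (fun s => Real.log (p s z.1)) z.2 := funext fun z => h1 z.1 z.2
  have e2 : Function.uncurry l2 =
      fun z : ℝ × ℝ => deriv (fun s => Function.uncurry l1 (z.1, s)) z.2 :=
    funext fun z => h2 z.1 z.2
  have e3 : Function.uncurry l3 =
      fun z : ℝ × ℝ => deriv (fun s => Function.uncurry l2 (z.1, s)) z.2 :=
    funext fun z => h3 z.1 z.2
  have s1 : ContDiffOn ℝ 3 (Function.uncurry l1) (𝒳 ×ˢ Θ) := by
    rw [e1]; exact hsmooth.deriv_snd hD (by norm_num)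
  have s2 : ContDiffOn ℝ 2 (Function.uncurry l2) (𝒳 ×ˢ Θ) := by
    rw [e2]; exact s1.deriv_snd hD (by norm_num)
  have s3 : ContDiffOn ℝ 1 (Function.uncurry l3) (𝒳 ×ˢ Θ) := by
    rw [e3]; exact s2.deriv_snd hD (by norm_num)
  have d1 : ∀ x ∈ 𝒳, ∀ t ∈ Θ, HasDerivAt (fun t => Real.log (p t x)) (l1 x t) t := by
    intro x hx t ht
    rw [h1]
    exact (hsmooth.hasDerivAt_snd hD (by norm_num)
      (Set.mk_mem_prod hx ht)).differentiableAt.hasDerivAt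
  have d2 : ∀ x ∈ 𝒳, ∀ t ∈ Θ, HasDerivAt (l1 x) (l2 x t) t := by
    intro x hx t ht
    rw [h2]
    exact (s1.hasDerivAt_snd hD (by norm_num) (Set.mk_mem_prod hx ht)).differentiableAt.hasDerivAt
  have d3 : ∀ x ∈ 𝒳, ∀ t ∈ Θ, HasDerivAt (l2 x) (l3 x t) t := by
    intro x hx t ht
    rw [h3]
    exact (s2.hasDerivAt_snd hD (by norm_num) (Set.mk_mem_prod hx ht)).differentiableAt.hasDerivAt
  have hp : ContinuousOn (Function.uncurry fun x t => p t x) (𝒳 ×ˢ Θ) :=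
    (Real.continuous_exp.comp_continuousOn hsmooth.continuousOn).congr fun z hz =>
      (Real.exp_log (hppos z.2 hz.2 z.1 hz.1)).symm
  have dp : ∀ x ∈ 𝒳, ∀ t ∈ Θ, HasDerivAt (fun t => p t x) (p t x * l1 x t) t := by
    intro x hx t ht
    have h := (d1 x hx t ht).exp
    rw [Real.exp_log (hppos t ht x hx)] at h
    exact h.congr_of_eventuallyEq
      ((hΘ.eventually_mem ht).mono fun s hs => (Real.exp_log (hppos s hs x hx)).symm)
  refine ⟨s1.continuousOn, d1, h𝒳.measurableSet, measurable_zeroExtend h𝒳 hΘ hp,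
    measurable_zeroExtend h𝒳 hΘ s1.continuousOn, measurable_zeroExtend h𝒳 hΘ s2.continuousOn,
    measurable_zeroExtend h𝒳 hΘ s3.continuousOn, ?_, ?_, ?_, ?_, ?_, ?_⟩
  · intro x hx t ht
    rw [zeroExtend_eq _ hx ht]
    exact hppos t ht x hx
  · intro x hx t ht
    rw [zeroExtend_eq _ hx ht, zeroExtend_eq _ hx ht]
    exact hasDerivAt_zeroExtend hΘ hx ht (dp x hx t ht)
  · intro x hx t ht
    rw [zeroExtend_eq _ hx ht]
    exact hasDerivAt_zeroExtend hΘ hx ht (d2 x hx t ht)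
  · intro x hx t ht
    rw [zeroExtend_eq _ hx ht]
    exact hasDerivAt_zeroExtend hΘ hx ht (d3 x hx t ht)
  · intro x hx
    have h : ContinuousOn (fun t => Function.uncurry l3 (x, t)) Θ :=
      s3.continuousOn.comp (by fun_prop) fun t ht => Set.mk_mem_prod hx ht
    exact h.congr fun t ht => zeroExtend_eq _ hx ht
  · intro t ht
    rw [setLIntegral_congr_fun h𝒳.measurableSet fun x hx => by
      rw [zeroExtend_eq (fun x t => p t x) hx ht]]
    have hi : IntegrableOn (p t) 𝒳 := by
      by_contra hcon
      have := hpint t ht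
      rw [integral_undef hcon] at this
      exact zero_ne_one this
    rw [← ofReal_integral_eq_lintegral_ofReal hi, hpint t ht, ENNReal.ofReal_one]
    filter_upwards [ae_restrict_mem h𝒳.measurableSet] with x hx using (hppos t ht x hx).le

theorem densityMeasure_zeroExtend {𝒳 Θ : Set ℝ} (h𝒳 : IsOpen 𝒳) (p : ℝ → ℝ → ℝ) {t : ℝ}
    (ht : t ∈ Θ) : densityMeasure 𝒳 (zeroExtend 𝒳 Θ fun x t => p t x) t =
      (volume.restrict 𝒳).withDensity fun x => ENNReal.ofReal (p t x) := by
  refine withDensity_congr_ae ?_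
  filter_upwards [ae_restrict_mem h𝒳.measurableSet] with x hx
  rw [zeroExtend_eq _ hx ht]

theorem lintegral_zeroExtend_ne_top {𝒳 Θ : Set ℝ} (h𝒳 : IsOpen 𝒳) {p l l1 l2 l3 : ℝ → ℝ → ℝ}
    (hf : IsLogDerivFamily 𝒳 Θ (zeroExtend 𝒳 Θ fun x t => p t x) l1 l2 l3)
    (hl : Measurable (Function.uncurry (zeroExtend 𝒳 Θ l))) {t : ℝ} (ht : t ∈ Θ)
    (hppos : ∀ x ∈ 𝒳, 0 < p t x) (hlp : IntegrableOn (fun x => l x t * p t x) 𝒳) :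
    ∫⁻ x, ENNReal.ofReal |zeroExtend 𝒳 Θ l x t|
      ∂densityMeasure 𝒳 (zeroExtend 𝒳 Θ fun x t => p t x) t ≠ ⊤ := by
  have hm : Measurable fun x => ENNReal.ofReal |zeroExtend 𝒳 Θ l x t| :=
    ENNReal.measurable_ofReal.comp (hl.comp (measurable_id.prodMk measurable_const)).abs
  rw [hf.lintegral_densityMeasure t hm,
    setLIntegral_congr_fun (g := fun x => ENNReal.ofReal ‖l x t * p t x‖) h𝒳.measurableSet]
  · exact (hasFiniteIntegral_iff_norm _).1 hlp.2 |>.ne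
  · intro x hx
    simp only
    rw [zeroExtend_eq _ hx ht, zeroExtend_eq _ hx ht, ← ENNReal.ofReal_mul (hppos x hx).le,
      norm_mul, Real.norm_eq_abs, Real.norm_of_nonneg (hppos x hx).le, mul_comm]

/-- If the MLE is (asymptotically) a smooth function of a sample mean, in the sense
that `q(θ̂ₙ(x)) = (1/n) ∑ g(xᵢ)` on sets `Eₙ` of asymptotically full probability,
then—under the regularity conditions (iv)–(x)—the family of densities is a
one-parameter exponential family: `log p θ x = w θ * T x + c θ + h x`. -/
theorem mle_linear_statistic_implies_exponential_family
    -- Θ and 𝒳 are open intervals in ℝ; μ is Lebesgue measure on 𝒳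
    (Θ 𝒳 : Set ℝ) (hΘopen : IsOpen Θ) (hΘconn : Θ.OrdConnected) (hΘne : Θ.Nonempty)
    (h𝒳open : IsOpen 𝒳) (h𝒳conn : 𝒳.OrdConnected) (h𝒳ne : 𝒳.Nonempty)
    -- the family of positive probability densities
    (p : ℝ → ℝ → ℝ)
    (hpmeas : ∀ θ ∈ Θ, Measurable (p θ))
    (hppos : ∀ θ ∈ Θ, ∀ x ∈ 𝒳, 0 < p θ x)
    (hpint : ∀ θ ∈ Θ, (∫ x in 𝒳, p θ x) = 1)
    -- the θ-derivatives ℓ1, ℓ2, ℓ3, ℓ4 of ℓ(x,θ) := log p θ x, and the mixed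
    -- derivative ℓx2 = ∂³ℓ/∂x∂θ²
    (ℓ1 ℓ2 ℓ3 ℓ4 ℓx2 : ℝ → ℝ → ℝ)
    (hℓ1 : ∀ x θ, ℓ1 x θ = deriv (fun t => Real.log (p t x)) θ)
    (hℓ2 : ∀ x θ, ℓ2 x θ = deriv (ℓ1 x) θ)
    (hℓ3 : ∀ x θ, ℓ3 x θ = deriv (ℓ2 x) θ)
    (hℓ4 : ∀ x θ, ℓ4 x θ = deriv (ℓ3 x) θ)
    (hℓx2 : ∀ x θ, ℓx2 x θ = deriv (fun y => ℓ2 y θ) x)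
    -- (iv): ℓ has continuous partial derivatives up to total order 4 on 𝒳 × Θ
    (hsmooth : ContDiffOn ℝ 4 (fun q : ℝ × ℝ => Real.log (p q.2 q.1)) (𝒳 ×ˢ Θ))
    -- (v): the Fisher information I(θ) = −E_θ ℓ″(X,θ) is finite, nonzero, continuous
    (I : ℝ → ℝ)
    (hIint : ∀ θ ∈ Θ, IntegrableOn (fun x => ℓ2 x θ * p θ x) 𝒳)
    (hIdef : ∀ θ ∈ Θ, I θ = -∫ x in 𝒳, ℓ2 x θ * p θ x)
    (hIne : ∀ θ ∈ Θ, I θ ≠ 0)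
    (hIcont : ContinuousOn I Θ)
    -- (vi)
    (hvi : ∀ θ ∈ Θ, ∃ ε : ℝ, 0 < ε ∧ Set.Icc (θ - ε) (θ + ε) ⊆ Θ ∧
      (IntegrableOn (fun x => (⨆ τ : Set.Icc (θ - ε) (θ + ε), |ℓ3 x (τ : ℝ)|) * p θ x) 𝒳
        ∨ ∃ d : ℝ, 0 < d ∧
            IntegrableOn
              (fun x => |x| ^ d * (⨆ τ : Set.Icc (θ - ε) (θ + ε), |ℓ2 x (τ : ℝ)|) * p θ x) 𝒳))
    -- (vii): E_θ ℓ‴_{θθθ}(X,θ) and E_θ ℓ‴_{xθθ}(X,θ) exist and are continuous in θ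
    (hint3 : ∀ θ ∈ Θ, IntegrableOn (fun x => ℓ3 x θ * p θ x) 𝒳)
    (hintx2 : ∀ θ ∈ Θ, IntegrableOn (fun x => ℓx2 x θ * p θ x) 𝒳)
    (hcont3 : ContinuousOn (fun θ => ∫ x in 𝒳, ℓ3 x θ * p θ x) Θ)
    (hcontx2 : ContinuousOn (fun θ => ∫ x in 𝒳, ℓx2 x θ * p θ x) Θ)
    -- (viii)
    (hviii : ∀ θ ∈ Θ, ∃ ε : ℝ, 0 < ε ∧ Set.Icc (θ - ε) (θ + ε) ⊆ Θ ∧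
      (IntegrableOn (fun x => (⨆ τ : Set.Icc (θ - ε) (θ + ε), |ℓ4 x (τ : ℝ)|) * p θ x) 𝒳
        ∨ ∃ d : ℝ, 0 < d ∧
            IntegrableOn
              (fun x => |x| ^ d * (⨆ τ : Set.Icc (θ - ε) (θ + ε), |ℓ3 x (τ : ℝ)|) * p θ x) 𝒳))
    -- the maximum likelihood estimator and (ix)
    (mle : (n : ℕ) → (Fin n → ℝ) → ℝ)
    (hmlemeas : ∀ n, Measurable (mle n))
    (hmleΘ : ∀ (n : ℕ) (x : Fin n → ℝ), (∀ i, x i ∈ 𝒳) → mle n x ∈ Θ)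
    (hmlemax : ∀ (n : ℕ) (x : Fin n → ℝ), (∀ i, x i ∈ 𝒳) →
      ∀ θ ∈ Θ, (∏ i, p θ (x i)) ≤ ∏ i, p (mle n x) (x i))
    (hmlecrit : ∀ (n : ℕ) (x : Fin n → ℝ), (∀ i, x i ∈ 𝒳) →
      (∑ i, ℓ1 (x i) (mle n x)) = 0)
    -- the law of a sample of size n under the parameter θ
    (ν : ℝ → Measure ℝ)
    (hν : ∀ θ, ν θ = (volume.restrict 𝒳).withDensity (fun x => ENNReal.ofReal (p θ x)))
    -- (x): consistency of the MLE
    (hconsist : ∀ θ ∈ Θ, ∀ ε : ℝ, 0 < ε →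
      Tendsto (fun n => Measure.pi (fun _ : Fin n => ν θ) {x | ε < |mle n x - θ|})
        atTop (nhds 0))
    -- the MLE is a smooth function of a sample mean on sets Eₙ of
    -- asymptotically full probability
    (q : ℝ → ℝ) (hq : ContDiffOn ℝ 2 q Θ) (hq' : ∀ θ ∈ Θ, deriv q θ ≠ 0)
    (g : ℝ → ℝ) (hg : Measurable g)
    (E : (n : ℕ) → Set (Fin n → ℝ)) (hEmeas : ∀ n, MeasurableSet (E n))
    (hEprob : ∀ θ ∈ Θ, Tendsto (fun n => Measure.pi (fun _ : Fin n => ν θ) (E n)ᶜ)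
      atTop (nhds 0))
    (hqg : ∀ n : ℕ, 1 ≤ n → ∀ x ∈ E n, mle n x ∈ Θ ∧
      q (mle n x) = (1 / (n : ℝ)) * ∑ i, g (x i)) :
    ∃ w c T h : ℝ → ℝ, ∀ θ ∈ Θ, ∀ x ∈ 𝒳,
      Real.log (p θ x) = w θ * T x + c θ + h x := by
  obtain ⟨hL, hd, hf⟩ := isLogDerivFamily_zeroExtend h𝒳open hΘopen hppos hpint hℓ1 hℓ2 hℓ3 hsmooth
  have hνeq : ∀ θ ∈ Θ, ν θ = densityMeasure 𝒳 (zeroExtend 𝒳 Θ fun x t => p t x) θ :=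
    fun θ hθ => by rw [hν, densityMeasure_zeroExtend h𝒳open p hθ]
  set U : Set ℝ := {c | c ∈ Θ ∧ ∃ G : Set ℝ, G ⊆ 𝒳 ∧ (∀ᵐ x ∂volume.restrict 𝒳, x ∈ G) ∧
      ∀ u ∈ G, ∀ v ∈ G, ∀ w ∈ G, (g u = g w → ℓ1 u c = ℓ1 w c) ∧
        (ℓ1 u c - ℓ1 w c) * (g v - g w) = (ℓ1 v c - ℓ1 w c) * (g u - g w)} with hU
  have hUd : Θ ⊆ closure U := by
    intro θ hθ
    rw [_root_.mem_closure_iff]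
    intro V hV hθV
    obtain ⟨c, r, hr, hsub, M, hM, hM2, hM3⟩ := hf.exists_Icc_lintegral_le (hV.inter hΘopen) hΘopen
      Set.inter_subset_right ⟨θ, hθV, hθ⟩
      (fun s hs => lintegral_zeroExtend_ne_top h𝒳open hf hf.measurable_two hs (hppos s hs)
        (hIint s hs))
      (fun s hs => lintegral_zeroExtend_ne_top h𝒳open hf hf.measurable_three hs (hppos s hs)
        (hint3 s hs))
    have hcm := hsub (show c ∈ Set.Icc (c - r) (c + r) from ⟨by linarith, by linarith⟩)
    have hc : c ∈ Θ := hcm.2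
    refine ⟨c, hcm.1, hc, ?_⟩
    have hqc : HasStrictDerivAt q (deriv q c) c :=
      ((hq.contDiffAt (hΘopen.mem_nhds hc)).hasStrictDerivAt (by norm_num))
    obtain ⟨G, hG, hGae, hGrel⟩ := hf.exists_ae_score_relation hr
      (hsub.trans Set.inter_subset_right) hM hM2 hM3 (τ := mle) (g := g) (E := E)
      (fun n x hx => by
        have h := hmlemax n x hx c hc
        rwa [Finset.prod_congr rfl fun i _ => (zeroExtend_eq (fun x t => p t x) (hx i) hc).symm,
          Finset.prod_congr rfl fun i _ =>
            (zeroExtend_eq (fun x t => p t x) (hx i) (hmleΘ n x hx)).symm] at h)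
      (fun n x hx hm => by
        rw [Finset.sum_congr rfl fun i _ => zeroExtend_eq ℓ1 (hx i) hm]
        exact hmlecrit n x hx)
      (fun δ hδ => by
        rw [← hνeq c hc]
        exact hconsist c hc δ hδ)
      hqc (hq' c hc)
      (by
        rw [← hνeq c hc]
        exact hEprob c hc)
      (fun n hn x hx => (hqg n hn x hx).2)
    refine ⟨G, hG, hGae, fun u hu v hv w hw => ?_⟩
    have h := hGrel u hu v hv w hw
    rwa [zeroExtend_eq ℓ1 (hG hu) hc, zeroExtend_eq ℓ1 (hG hv) hc,
      zeroExtend_eq ℓ1 (hG hw) hc] at h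
  exact exists_eq_mul_add_of_score_relation hΘopen hΘconn hΘne h𝒳open h𝒳ne
    (ℓ := fun x t => Real.log (p t x)) hd
    (fun t ht => hL.comp (by fun_prop : ContinuousOn (fun x => (x, t)) 𝒳)
      fun x hx => Set.mk_mem_prod hx ht)
    (fun x hx => hL.comp (by fun_prop : ContinuousOn (fun t => (x, t)) Θ)
      fun t ht => Set.mk_mem_prod hx ht)
    (fun c hc => hc.1) hUd (fun c hc => hc.2)
end

section
/- Let z̄, ū, r̄, r* be real numbers with ū > 0, |r̄| ≤ r*, and ū² > 2|z̄| r*. Then ū² − 2 z̄ r̄ ≥ ū² − 2|z̄| r* > 0; the number t := 2z̄ / ( ū + √(ū² − 2 z̄ r̄) ) satisfies the quadratic equation z̄ − t ū + (t²/2) r̄ = 0; and t lies between T₋ := 2z̄ / ( ū + √(ū² + 2|z̄| r*) ) and T₊ := 2z̄ / ( ū + √(ū² − 2|z̄| r*) ), i.e. min(T₋, T₊) ≤ t ≤ max(T₋, T₊). -/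
/-- Deterministic bracketing step: if `ū > 0`, `|r̄| ≤ r*`, and `ū² > 2|z̄| r*`, then
`ū² − 2 z̄ r̄ ≥ ū² − 2|z̄| r* > 0`; the number `t := 2z̄/(ū + √(ū² − 2 z̄ r̄))` solves
the quadratic equation `z̄ − t ū + (t²/2) r̄ = 0`; and `t` lies between
`T₋ := 2z̄/(ū + √(ū² + 2|z̄| r*))` and `T₊ := 2z̄/(ū + √(ū² − 2|z̄| r*))`. -/
theorem mle_bracketing_quadratic
    (zb ub rb rs : ℝ) (hub : 0 < ub) (hrb : |rb| ≤ rs)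
    (hdisc : 2 * |zb| * rs < ub ^ 2) :
    (ub ^ 2 - 2 * |zb| * rs ≤ ub ^ 2 - 2 * zb * rb ∧ 0 < ub ^ 2 - 2 * |zb| * rs) ∧
    (zb - (2 * zb / (ub + Real.sqrt (ub ^ 2 - 2 * zb * rb))) * ub
        + (2 * zb / (ub + Real.sqrt (ub ^ 2 - 2 * zb * rb))) ^ 2 / 2 * rb = 0) ∧
    (min (2 * zb / (ub + Real.sqrt (ub ^ 2 + 2 * |zb| * rs)))
         (2 * zb / (ub + Real.sqrt (ub ^ 2 - 2 * |zb| * rs)))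
       ≤ 2 * zb / (ub + Real.sqrt (ub ^ 2 - 2 * zb * rb)) ∧
     2 * zb / (ub + Real.sqrt (ub ^ 2 - 2 * zb * rb))
       ≤ max (2 * zb / (ub + Real.sqrt (ub ^ 2 + 2 * |zb| * rs)))
             (2 * zb / (ub + Real.sqrt (ub ^ 2 - 2 * |zb| * rs)))) := by
  have habs : |zb * rb| ≤ |zb| * rs := by
    rw [abs_mul]
    exact mul_le_mul_of_nonneg_left hrb (abs_nonneg zb)
  obtain ⟨hlow, hup⟩ := abs_le.mp habs
  have hle : ub ^ 2 - 2 * |zb| * rs ≤ ub ^ 2 - 2 * zb * rb := by linarith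
  have hge : ub ^ 2 - 2 * zb * rb ≤ ub ^ 2 + 2 * |zb| * rs := by linarith
  have hpos : 0 < ub ^ 2 - 2 * |zb| * rs := by linarith
  refine ⟨⟨hle, hpos⟩, ?_, ?_⟩
  · have hsq := Real.sq_sqrt (hpos.le.trans hle)
    have hden : ub + √(ub ^ 2 - 2 * zb * rb) ≠ 0 := by positivity
    generalize √(ub ^ 2 - 2 * zb * rb) = s at hsq hden ⊢
    field_simp
    linear_combination zb * hsq
  · have hsqrt_le := Real.sqrt_le_sqrt hle
    have hsqrt_ge := Real.sqrt_le_sqrt hge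
    rcases le_total 0 zb with hz | hz
    · refine ⟨min_le_of_left_le ?_, le_max_of_le_right ?_⟩ <;>
        exact div_le_div_of_nonneg_left (by linarith) (by positivity) (by linarith)
    · refine ⟨min_le_of_right_le ?_, le_max_of_le_left ?_⟩ <;>
        exact (div_le_div_iff₀ (by positivity) (by positivity)).2
          (mul_le_mul_of_nonpos_left (by linarith) (by linarith))
end

section
/- Let k > 0 and for θ > 0 let p_θ(x) := (k/θ)(x/θ)^{k−1} e^{−(x/θ)^k} for x > 0 (and p_θ(x) := 0 for x ≤ 0) be the density of the Weibull distribution W(k, θ). Then for all θ, θ0 > 0, the squared Hellinger distance satisfies ∫_ℝ ( √(p_θ(x)) − √(p_{θ0}(x)) )² dx = 2 − 4 (θ θ0)^{k/2} / (θ^k + θ0^k). -/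
open MeasureTheory Real

open Set

theorem integrableOn_rpow_sub_one_mul_exp {k c : ℝ} (hk : 0 < k) (hc : 0 < c) :
    IntegrableOn (fun x : ℝ => x ^ (k - 1) * exp (-c * x ^ k)) (Ioi 0) :=
  integrableOn_rpow_mul_exp_neg_mul_rpow (by linarith) hk hc

theorem integral_rpow_sub_one_mul_exp {k c : ℝ} (hk : 0 < k) (hc : 0 < c) :
    ∫ x in Ioi (0 : ℝ), x ^ (k - 1) * exp (-c * x ^ k) = 1 / (k * c) := by
  rw [integral_rpow_mul_exp_neg_mul_rpow hk (by linarith) hc, sub_add_cancel, neg_div,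
    div_self hk.ne', Gamma_one, rpow_neg_one]
  field_simp

theorem weibull_density_eq {k θ x : ℝ} (hθ : 0 < θ) (hx : 0 < x) :
    k / θ * (x / θ) ^ (k - 1) * exp (-(x / θ) ^ k)
      = k * (1 / (θ ^ (k / 2)) ^ 2) * (x ^ (k - 1) * exp (-(1 / (θ ^ (k / 2)) ^ 2) * x ^ k)) := by
  have hsq : (θ ^ (k / 2)) ^ 2 = θ ^ k := by
    rw [← rpow_mul_natCast hθ.le]
    norm_num
  have hpow : θ ^ k = θ ^ (k - 1) * θ := by
    rw [← rpow_add_one hθ.ne', sub_add_cancel]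
  have hexp : -(x / θ) ^ k = -(1 / θ ^ k) * x ^ k := by
    rw [div_rpow hx.le hθ.le]
    ring
  rw [hsq, hexp, div_rpow hx.le hθ.le, hpow]
  field_simp

theorem sq_sqrt_sub_sqrt_of_exp {k u v y z : ℝ} (hk : 0 < k) (hu : 0 < u) (hv : 0 < v)
    (hy : 0 ≤ y) :
    (√(k * (1 / u ^ 2) * (y * exp (-(1 / u ^ 2) * z)))
        - √(k * (1 / v ^ 2) * (y * exp (-(1 / v ^ 2) * z)))) ^ 2
      = k * (1 / u ^ 2) * (y * exp (-(1 / u ^ 2) * z))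
        + k * (1 / v ^ 2) * (y * exp (-(1 / v ^ 2) * z))
        - 2 * k / (u * v) * (y * exp (-((1 / u ^ 2 + 1 / v ^ 2) / 2) * z)) := by
  set c := (1 / u ^ 2 + 1 / v ^ 2) / 2 with hc
  have hp : 0 ≤ k * (1 / u ^ 2) * (y * exp (-(1 / u ^ 2) * z)) := by positivity
  have hq : 0 ≤ k * (1 / v ^ 2) * (y * exp (-(1 / v ^ 2) * z)) := by positivity
  have hexp : exp (-(1 / u ^ 2) * z) * exp (-(1 / v ^ 2) * z) = exp (-c * z) ^ 2 := by
    rw [← exp_add, ← exp_nat_mul, hc]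
    congr 1
    push_cast
    ring
  have hprod : √(k * (1 / u ^ 2) * (y * exp (-(1 / u ^ 2) * z)))
      * √(k * (1 / v ^ 2) * (y * exp (-(1 / v ^ 2) * z)))
        = k / (u * v) * (y * exp (-c * z)) := by
    rw [← sqrt_mul hp]
    have hsq : k * (1 / u ^ 2) * (y * exp (-(1 / u ^ 2) * z))
        * (k * (1 / v ^ 2) * (y * exp (-(1 / v ^ 2) * z)))
          = (k / (u * v) * (y * exp (-c * z))) ^ 2 := by
      linear_combination k ^ 2 * (1 / u ^ 2) * (1 / v ^ 2) * y ^ 2 * hexp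
    rw [hsq, sqrt_sq (by positivity)]
  rw [sub_sq, sq_sqrt hp, sq_sqrt hq, mul_assoc 2, hprod]
  ring

/-- Squared Hellinger distance between two Weibull densities with common shape `k`:
`∫ (√p_θ − √p_{θ0})² = 2 − 4 (θ θ0)^{k/2} / (θ^k + θ0^k)`. -/
theorem hellinger_weibull_scale
    (k : ℝ) (hk : 0 < k) (θ θ0 : ℝ) (hθ : 0 < θ) (hθ0 : 0 < θ0) :
    (∫ x : ℝ,
        (Real.sqrt (if 0 < x then k / θ * (x / θ) ^ (k - 1) * Real.exp (-(x / θ) ^ k) else 0)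
          - Real.sqrt
              (if 0 < x then k / θ0 * (x / θ0) ^ (k - 1) * Real.exp (-(x / θ0) ^ k) else 0)) ^ 2)
      = 2 - 4 * (θ * θ0) ^ (k / 2) / (θ ^ k + θ0 ^ k) := by
  have hu : 0 < θ ^ (k / 2) := rpow_pos_of_pos hθ _
  have hv : 0 < θ0 ^ (k / 2) := rpow_pos_of_pos hθ0 _
  have hsq : ∀ t : ℝ, 0 < t → t ^ k = (t ^ (k / 2)) ^ 2 := fun t ht => by
    rw [← rpow_mul_natCast ht.le]
    norm_num
  rw [← setIntegral_eq_integral_of_forall_compl_eq_zero (s := Ioi 0)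
    (fun x hx => by simp [show ¬ 0 < x from hx])]
  rw [setIntegral_congr_fun measurableSet_Ioi (fun x (hx : 0 < x) => by
    simp only [if_pos hx]
    rw [weibull_density_eq hθ hx, weibull_density_eq hθ0 hx])]
  rw [setIntegral_congr_fun measurableSet_Ioi (fun x (hx : 0 < x) =>
    sq_sqrt_sub_sqrt_of_exp hk hu hv (rpow_nonneg hx.le _))]
  rw [hsq θ hθ, hsq θ0 hθ0, mul_rpow hθ.le hθ0.le]
  generalize θ ^ (k / 2) = u at hu ⊢
  generalize θ0 ^ (k / 2) = v at hv ⊢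
  have ha : 0 < 1 / u ^ 2 := by positivity
  have hb : 0 < 1 / v ^ 2 := by positivity
  have hc : 0 < (1 / u ^ 2 + 1 / v ^ 2) / 2 := by positivity
  have ia := (integrableOn_rpow_sub_one_mul_exp hk ha).const_mul (k * (1 / u ^ 2))
  have ib := (integrableOn_rpow_sub_one_mul_exp hk hb).const_mul (k * (1 / v ^ 2))
  have ic := (integrableOn_rpow_sub_one_mul_exp hk hc).const_mul (2 * k / (u * v))
  rw [integral_sub (by exact ia.add ib) ic, integral_add ia ib, integral_const_mul, integral_const_mul,
    integral_const_mul, integral_rpow_sub_one_mul_exp hk ha, integral_rpow_sub_one_mul_exp hk hb,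
    integral_rpow_sub_one_mul_exp hk hc]
  field_simp
  ring
end
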